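/- arXiv:2203.09321 — 10 statements merged into one kernel-verified Lean document; each statement's English description precedes it below -/
import Mathlib

section
/- For every closed term P over the signature Σ_CP(A) there exists a basic form Q such that CP ⊢ P = Q. -/
/-- Closed terms over Σ_CP(A): constants T, F, atoms, and the ternary conditional. -/
inductive CTerm (A : Type) : Type
  | T : CTerm A
  | F : CTerm A
  | at_ : A → CTerm A
  | cond : CTerm A → CTerm A → CTerm A → CTerm A

/-- Basic forms over A. -/
inductive IsBasic {A : Type} : CTerm A → Prop
  | T : IsBasic CTerm.T
  | F : IsBasic CTerm.F
  | cond {p q : CTerm A} (a : A) : IsBasic p → IsBasic q →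
      IsBasic (CTerm.cond p (CTerm.at_ a) q)

/-- CP-derivability: the smallest congruence containing (CP1)–(CP4). -/
inductive CP {A : Type} : CTerm A → CTerm A → Prop
  | refl (p : CTerm A) : CP p p
  | symm {p q : CTerm A} : CP p q → CP q p
  | trans {p q r : CTerm A} : CP p q → CP q r → CP p r
  | congr {p p' q q' r r' : CTerm A} : CP p p' → CP q q' → CP r r' →
      CP (CTerm.cond p q r) (CTerm.cond p' q' r')
  | cp1 (x y : CTerm A) : CP (CTerm.cond x CTerm.T y) x
  | cp2 (x y : CTerm A) : CP (CTerm.cond x CTerm.F y) y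
  | cp3 (x : CTerm A) : CP (CTerm.cond CTerm.T x CTerm.F) x
  | cp4 (x y z u v : CTerm A) :
      CP (CTerm.cond x (CTerm.cond y z u) v)
         (CTerm.cond (CTerm.cond x y v) z (CTerm.cond x u v))

/-- A conditional whose three arguments are basic forms is derivably equal to a basic form. -/
theorem IsBasic.exists_cond {A : Type} {p q r : CTerm A} (hp : IsBasic p) (hq : IsBasic q)
    (hr : IsBasic r) : ∃ s : CTerm A, IsBasic s ∧ CP (CTerm.cond p q r) s := by
  induction hq with
  | T => exact ⟨p, hp, .cp1 p r⟩
  | F => exact ⟨r, hr, .cp2 p r⟩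
  | cond a _ _ ih₁ ih₂ =>
    obtain ⟨s₁, hs₁, h₁⟩ := ih₁
    obtain ⟨s₂, hs₂, h₂⟩ := ih₂
    exact ⟨_, .cond a hs₁ hs₂, .trans (.cp4 _ _ _ _ _) (.congr h₁ (.refl _) h₂)⟩

/-- For every closed term P over Σ_CP(A) there exists a basic form Q with CP ⊢ P = Q. -/
theorem cp_exists_basic_form {A : Type} (P : CTerm A) :
    ∃ Q : CTerm A, IsBasic Q ∧ CP P Q := by
  induction P with
  | T => exact ⟨_, .T, .refl _⟩
  | F => exact ⟨_, .F, .refl _⟩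
  | at_ a => exact ⟨_, .cond a .T .F, .symm (.cp3 _)⟩
  | cond _ _ _ ihp ihq ihr =>
    obtain ⟨p, hp, h₁⟩ := ihp
    obtain ⟨q, hq, h₂⟩ := ihq
    obtain ⟨r, hr, h₃⟩ := ihr
    obtain ⟨s, hs, h⟩ := hp.exists_cond hq hr
    exact ⟨s, hs, .trans (.congr h₁ h₂ h₃) h⟩
end

section
/- For every closed term P over Σ_CP(A), bf(P) is a basic form; and for every basic form P, bf(P) = P. -/
/-- The substitution P[T↦Q, F↦R] (defined on basic forms; extended trivially elsewhere). -/
def subst {A : Type} (Q R : CTerm A) : CTerm A → CTerm A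
  | CTerm.T => Q
  | CTerm.F => R
  | CTerm.at_ a => CTerm.at_ a
  | CTerm.cond p1 c p2 => CTerm.cond (subst Q R p1) c (subst Q R p2)

/-- The basic form function bf. -/
def bf {A : Type} : CTerm A → CTerm A
  | CTerm.T => CTerm.T
  | CTerm.F => CTerm.F
  | CTerm.at_ a => CTerm.cond CTerm.T (CTerm.at_ a) CTerm.F
  | CTerm.cond p q r => subst (bf p) (bf r) (bf q)

theorem IsBasic.subst {A : Type} {P Q R : CTerm A} (hP : IsBasic P) (hQ : IsBasic Q)
    (hR : IsBasic R) : IsBasic (subst Q R P) := by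
  induction hP with
  | T => exact hQ
  | F => exact hR
  | cond a _ _ ih₁ ih₂ => exact .cond a ih₁ ih₂

theorem isBasic_bf {A : Type} (P : CTerm A) : IsBasic (bf P) := by
  induction P with
  | T => exact .T
  | F => exact .F
  | at_ a => exact .cond a .T .F
  | cond _ _ _ ihp ihq ihr => exact ihq.subst ihp ihr

theorem IsBasic.bf_eq {A : Type} {P : CTerm A} (hP : IsBasic P) : bf P = P := by
  induction hP with
  | T => rfl
  | F => rfl
  | cond a _ _ ih₁ ih₂ => simp only [bf, _root_.subst, ih₁, ih₂]

/-- For every closed term P, bf(P) is a basic form; and for every basic form P, bf(P) = P. -/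
theorem bf_isBasic_and_bf_fixes_basic {A : Type} :
    (∀ P : CTerm A, IsBasic (bf P)) ∧ (∀ P : CTerm A, IsBasic P → bf P = P) :=
  ⟨isBasic_bf, fun _ hP => hP.bf_eq⟩
end

section
/- For all closed terms P, P1, P2, Q1, Q2 over Σ_CP(A), bf(Q1 ◁ (P1 ◁ P ▷ P2) ▷ Q2) = bf((Q1 ◁ P1 ▷ Q2) ◁ P ▷ (Q1 ◁ P2 ▷ Q2)). -/
/-- Successive substitutions compose. -/
theorem subst_subst {A : Type} (Q R Q' R' p : CTerm A) :
    subst Q' R' (subst Q R p) = subst (subst Q' R' Q) (subst Q' R' R) p := by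
  induction p with
  | T => rfl
  | F => rfl
  | at_ a => rfl
  | cond p₁ c p₂ ih₁ _ ih₂ => simp only [subst, ih₁, ih₂]

/-- bf(Q1 ◁ (P1 ◁ P ▷ P2) ▷ Q2) = bf((Q1 ◁ P1 ▷ Q2) ◁ P ▷ (Q1 ◁ P2 ▷ Q2)). -/
theorem bf_cp4 {A : Type} (P P1 P2 Q1 Q2 : CTerm A) :
    bf (CTerm.cond Q1 (CTerm.cond P1 P P2) Q2)
      = bf (CTerm.cond (CTerm.cond Q1 P1 Q2) P (CTerm.cond Q1 P2 Q2)) := by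
  simp only [bf, subst_subst]
end

section
/- Duality principle for CP: for all closed terms P, Q over Σ_CP(A), CP ⊢ P = Q if and only if CP ⊢ P^dl = Q^dl, where (·)^dl is the duality mapping. -/
/-- The duality mapping. -/
def dl {A : Type} : CTerm A → CTerm A
  | CTerm.T => CTerm.F
  | CTerm.F => CTerm.T
  | CTerm.at_ a => CTerm.at_ a
  | CTerm.cond p q r => CTerm.cond (dl r) (dl q) (dl p)

theorem dl_dl {A : Type} (p : CTerm A) : dl (dl p) = p := by
  induction p with
  | T => rfl
  | F => rfl
  | at_ a => rfl
  | cond p q r hp hq hr => simp only [dl, hp, hq, hr]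

theorem CP.dl {A : Type} {p q : CTerm A} (h : CP p q) : CP (dl p) (dl q) := by
  induction h with
  | refl p => exact .refl _
  | symm _ ih => exact ih.symm
  | trans _ _ ih₁ ih₂ => exact ih₁.trans ih₂
  | congr _ _ _ ihp ihq ihr => exact .congr ihr ihq ihp
  | cp1 x y => exact .cp2 _ _
  | cp2 x y => exact .cp1 _ _
  | cp3 x => exact .cp3 _
  | cp4 x y z u v => exact .cp4 _ _ _ _ _

/-- Duality principle for CP: CP ⊢ P = Q iff CP ⊢ P^dl = Q^dl. -/
theorem cp_duality {A : Type} (P Q : CTerm A) :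
    CP P Q ↔ CP (dl P) (dl Q) := by
  exact ⟨CP.dl, fun h => by simpa only [dl_dl] using h.dl⟩
end

section
/- The dual of the memorisation axiom is derivable in CPmem: for all closed terms x, y, z, u, v, w over Σ_CP(A), CPmem ⊢ ((w ◁ y ▷ v) ◁ u ▷ z) ◁ y ▷ x = (w ◁ u ▷ z) ◁ y ▷ x. -/
/-- CPmem-derivability: the smallest congruence containing (CP1)–(CP4) and (CPmem). -/
inductive CPmem {A : Type} : CTerm A → CTerm A → Prop
  | refl (p : CTerm A) : CPmem p p
  | symm {p q : CTerm A} : CPmem p q → CPmem q p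
  | trans {p q r : CTerm A} : CPmem p q → CPmem q r → CPmem p r
  | congr {p p' q q' r r' : CTerm A} : CPmem p p' → CPmem q q' → CPmem r r' →
      CPmem (CTerm.cond p q r) (CTerm.cond p' q' r')
  | cp1 (x y : CTerm A) : CPmem (CTerm.cond x CTerm.T y) x
  | cp2 (x y : CTerm A) : CPmem (CTerm.cond x CTerm.F y) y
  | cp3 (x : CTerm A) : CPmem (CTerm.cond CTerm.T x CTerm.F) x
  | cp4 (x y z u v : CTerm A) :
      CPmem (CTerm.cond x (CTerm.cond y z u) v)
            (CTerm.cond (CTerm.cond x y v) z (CTerm.cond x u v))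
  | cpmem (x y z u v w : CTerm A) :
      CPmem (CTerm.cond x y (CTerm.cond z u (CTerm.cond v y w)))
            (CTerm.cond x y (CTerm.cond z u w))

/-- Conditioning on the negation `F ◁ y ▷ T` of `y` swaps the two branches. -/
theorem CPmem.cond_neg {A : Type} (x y z : CTerm A) :
    CPmem (CTerm.cond x (CTerm.cond CTerm.F y CTerm.T) z) (CTerm.cond z y x) :=
  (CPmem.cp4 x CTerm.F y CTerm.T z).trans
    (CPmem.congr (CPmem.cp2 x z) (CPmem.refl y) (CPmem.cp1 x z))

/-- The dual of the memorisation axiom is derivable in CPmem. -/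
theorem cpmem_dual_mem {A : Type} (x y z u v w : CTerm A) :
    CPmem (CTerm.cond (CTerm.cond (CTerm.cond w y v) u z) y x)
          (CTerm.cond (CTerm.cond w u z) y x) := by
  have hl := (CPmem.cond_neg x y _).trans (CPmem.congr ((CPmem.cond_neg z u _).trans
    (CPmem.congr (CPmem.cond_neg v y w) (CPmem.refl u) (CPmem.refl z)))
    (CPmem.refl y) (CPmem.refl x))
  have hr := (CPmem.cond_neg x y _).trans
    (CPmem.congr (CPmem.cond_neg z u w) (CPmem.refl y) (CPmem.refl x))
  exact hl.symm.trans ((CPmem.cpmem x _ z _ v w).trans hr)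
end

section
/- The contraction laws are derivable in CPmem: for all closed terms x, y, z, u over Σ_CP(A), CPmem ⊢ (x ◁ y ▷ z) ◁ y ▷ u = x ◁ y ▷ u and CPmem ⊢ x ◁ y ▷ (z ◁ y ▷ u) = x ◁ y ▷ u. -/
namespace CPmem

variable {A : Type}

/-- Negating the condition swaps the branches. -/
theorem cond_neg_s7 (x y z : CTerm A) :
    CPmem (CTerm.cond x (CTerm.cond CTerm.F y CTerm.T) z) (CTerm.cond z y x) :=
  (cp4 x CTerm.F y CTerm.T z).trans (congr (cp2 x z) (refl y) (cp1 x z))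

theorem contract_right (x y z u : CTerm A) :
    CPmem (CTerm.cond x y (CTerm.cond z y u)) (CTerm.cond x y u) :=
  (congr (refl x) (refl y) (cp2 CTerm.T (CTerm.cond z y u)).symm).trans <|
    (cpmem x y CTerm.T CTerm.F z u).trans <|
      congr (refl x) (refl y) (cp2 CTerm.T u)

theorem contract_left (x y z u : CTerm A) :
    CPmem (CTerm.cond (CTerm.cond x y z) y u) (CTerm.cond x y u) :=
  (cond_neg_s7 u y (CTerm.cond x y z)).symm.trans <|
    (congr (refl u) (refl _) (cond_neg_s7 z y x).symm).trans <|
      (contract_right u (CTerm.cond CTerm.F y CTerm.T) z x).trans <|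
        cond_neg_s7 u y x

end CPmem

/-- The contraction laws are derivable in CPmem. -/
theorem cpmem_contraction {A : Type} (x y z u : CTerm A) :
    CPmem (CTerm.cond (CTerm.cond x y z) y u) (CTerm.cond x y u) ∧
    CPmem (CTerm.cond x y (CTerm.cond z y u)) (CTerm.cond x y u) :=
  ⟨CPmem.contract_left x y z u, CPmem.contract_right x y z u⟩
end

section
/- Hoare's conditional is definable from the left-sequential connectives in CPmem(¬, ∧❛, ∨❛): for all closed terms x, y, z over Σ(A), CPmem(¬, ∧❛, ∨❛) ⊢ (x ∧❛ y) ∨❛ (¬x ∧❛ z) = y ◁ x ▷ z. -/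
/-- Closed terms over the extended signature Σ(A) = Σ_CP(A) ∪ Σ_SCL(A). -/
inductive Tm (A : Type) : Type
  | T : Tm A
  | F : Tm A
  | at_ : A → Tm A
  | cond : Tm A → Tm A → Tm A → Tm A
  | neg : Tm A → Tm A
  | and : Tm A → Tm A → Tm A
  | or : Tm A → Tm A → Tm A

/-- CPmem(¬, ∧❛, ∨❛)-derivability. -/
inductive CPmemX {A : Type} : Tm A → Tm A → Prop
  | refl (p : Tm A) : CPmemX p p
  | symm {p q : Tm A} : CPmemX p q → CPmemX q p
  | trans {p q r : Tm A} : CPmemX p q → CPmemX q r → CPmemX p r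
  | congr_cond {p p' q q' r r' : Tm A} : CPmemX p p' → CPmemX q q' → CPmemX r r' →
      CPmemX (Tm.cond p q r) (Tm.cond p' q' r')
  | congr_neg {p p' : Tm A} : CPmemX p p' → CPmemX (Tm.neg p) (Tm.neg p')
  | congr_and {p p' q q' : Tm A} : CPmemX p p' → CPmemX q q' →
      CPmemX (Tm.and p q) (Tm.and p' q')
  | congr_or {p p' q q' : Tm A} : CPmemX p p' → CPmemX q q' →
      CPmemX (Tm.or p q) (Tm.or p' q')
  | cp1 (x y : Tm A) : CPmemX (Tm.cond x Tm.T y) x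
  | cp2 (x y : Tm A) : CPmemX (Tm.cond x Tm.F y) y
  | cp3 (x : Tm A) : CPmemX (Tm.cond Tm.T x Tm.F) x
  | cp4 (x y z u v : Tm A) :
      CPmemX (Tm.cond x (Tm.cond y z u) v)
             (Tm.cond (Tm.cond x y v) z (Tm.cond x u v))
  | cpmem (x y z u v w : Tm A) :
      CPmemX (Tm.cond x y (Tm.cond z u (Tm.cond v y w)))
             (Tm.cond x y (Tm.cond z u w))
  | negdef (x : Tm A) : CPmemX (Tm.neg x) (Tm.cond Tm.F x Tm.T)
  | anddef (x y : Tm A) : CPmemX (Tm.and x y) (Tm.cond y x Tm.F)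
  | ordef (x y : Tm A) : CPmemX (Tm.or x y) (Tm.neg (Tm.and (Tm.neg x) (Tm.neg y)))


namespace CPmemX

variable {A : Type}

instance : Trans (@CPmemX A) (@CPmemX A) (@CPmemX A) := ⟨CPmemX.trans⟩

theorem cond_neg (a b x : Tm A) : CPmemX (Tm.cond b (Tm.neg x) a) (Tm.cond a x b) :=
  calc
    CPmemX (Tm.cond b (Tm.neg x) a) (Tm.cond b (Tm.cond Tm.F x Tm.T) a) :=
      congr_cond (refl _) (negdef x) (refl _)
    CPmemX _ (Tm.cond (Tm.cond b Tm.F a) x (Tm.cond b Tm.T a)) := cp4 ..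
    CPmemX _ (Tm.cond a x b) := congr_cond (cp2 ..) (refl _) (cp1 ..)

theorem neg_neg (x : Tm A) : CPmemX (Tm.neg (Tm.neg x)) x :=
  (negdef _).trans ((cond_neg ..).trans (cp3 x))

theorem or_eq_cond (x y : Tm A) : CPmemX (Tm.or x y) (Tm.cond Tm.T x y) :=
  calc
    CPmemX (Tm.or x y) (Tm.neg (Tm.and (Tm.neg x) (Tm.neg y))) := ordef x y
    CPmemX _ (Tm.cond Tm.F (Tm.and (Tm.neg x) (Tm.neg y)) Tm.T) := negdef _
    CPmemX _ (Tm.cond Tm.F (Tm.cond (Tm.neg y) (Tm.neg x) Tm.F) Tm.T) :=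
      congr_cond (refl _) (anddef ..) (refl _)
    CPmemX _ (Tm.cond Tm.F (Tm.cond Tm.F x (Tm.neg y)) Tm.T) :=
      congr_cond (refl _) (cond_neg ..) (refl _)
    CPmemX _ (Tm.cond (Tm.cond Tm.F Tm.F Tm.T) x (Tm.cond Tm.F (Tm.neg y) Tm.T)) := cp4 ..
    CPmemX _ (Tm.cond Tm.T x y) :=
      congr_cond (cp2 ..) (refl _) ((negdef _).symm.trans (neg_neg y))

theorem cond_cond_right (a x v w : Tm A) :
    CPmemX (Tm.cond a x (Tm.cond v x w)) (Tm.cond a x w) :=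
  calc
    CPmemX (Tm.cond a x (Tm.cond v x w)) (Tm.cond a x (Tm.cond Tm.T Tm.F (Tm.cond v x w))) :=
      congr_cond (refl _) (refl _) (cp2 ..).symm
    CPmemX _ (Tm.cond a x (Tm.cond Tm.T Tm.F w)) := cpmem ..
    CPmemX _ (Tm.cond a x w) := congr_cond (refl _) (refl _) (cp2 ..)

theorem cpmem_left (a u v w x b : Tm A) :
    CPmemX (Tm.cond (Tm.cond a u (Tm.cond v x w)) x b) (Tm.cond (Tm.cond a u v) x b) :=
  calc
    CPmemX (Tm.cond (Tm.cond a u (Tm.cond v x w)) x b)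
        (Tm.cond b (Tm.neg x) (Tm.cond a u (Tm.cond v x w))) := (cond_neg ..).symm
    CPmemX _ (Tm.cond b (Tm.neg x) (Tm.cond a u (Tm.cond w (Tm.neg x) v))) :=
      congr_cond (refl _) (refl _) (congr_cond (refl _) (refl _) (cond_neg ..).symm)
    CPmemX _ (Tm.cond b (Tm.neg x) (Tm.cond a u v)) := cpmem ..
    CPmemX _ (Tm.cond (Tm.cond a u v) x b) := cond_neg ..

end CPmemX

/-- Hoare's conditional is definable from the left-sequential connectives:
CPmem(¬, ∧❛, ∨❛) ⊢ (x ∧❛ y) ∨❛ (¬x ∧❛ z) = y ◁ x ▷ z. -/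
theorem cond_definable {A : Type} (x y z : Tm A) :
    CPmemX (Tm.or (Tm.and x y) (Tm.and (Tm.neg x) z)) (Tm.cond y x z) := by
  open CPmemX in
  exact calc
    CPmemX (Tm.or (Tm.and x y) (Tm.and (Tm.neg x) z))
        (Tm.cond Tm.T (Tm.and x y) (Tm.and (Tm.neg x) z)) := or_eq_cond ..
    CPmemX _ (Tm.cond Tm.T (Tm.cond y x Tm.F) (Tm.cond Tm.F x z)) :=
      congr_cond (refl _) (anddef ..) ((anddef ..).trans (cond_neg ..))
    CPmemX _ (Tm.cond (Tm.cond Tm.T y (Tm.cond Tm.F x z)) x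
        (Tm.cond Tm.T Tm.F (Tm.cond Tm.F x z))) := cp4 ..
    CPmemX _ (Tm.cond (Tm.cond Tm.T y Tm.F) x (Tm.cond Tm.T Tm.F (Tm.cond Tm.F x z))) :=
      cpmem_left ..
    CPmemX _ (Tm.cond y x (Tm.cond Tm.F x z)) := congr_cond (cp3 y) (refl _) (cp2 ..)
    CPmemX _ (Tm.cond y x z) := cond_cond_right ..
end

section
/- Every axiom of EqMSCL is derivable in EqMSCLℓI; in particular EqMSCLℓI ⊢ F = ¬T, EqMSCLℓI ⊢ T ∧❛ x = x, and EqMSCLℓI ⊢ (x ∨❛ y) ∧❛ z = (¬x ∧❛ (y ∧❛ z)) ∨❛ (x ∧❛ z). -/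
/-- Terms over Σ_SCLℓI(A): variables, T, F, ¬, ∧❛, ∨❛, ↔❛. -/
inductive ITerm : Type
  | var : Nat → ITerm
  | T : ITerm
  | F : ITerm
  | neg : ITerm → ITerm
  | and : ITerm → ITerm → ITerm
  | or : ITerm → ITerm → ITerm
  | iff : ITerm → ITerm → ITerm

/-- Derivability from EqMSCLℓI in equational logic (axioms are taken as schemes,
so closure under substitution is built in). -/
inductive DerivLI : ITerm → ITerm → Prop
  | refl (p : ITerm) : DerivLI p p
  | symm {p q : ITerm} : DerivLI p q → DerivLI q p
  | trans {p q r : ITerm} : DerivLI p q → DerivLI q r → DerivLI p r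
  | congr_neg {p p' : ITerm} : DerivLI p p' → DerivLI (ITerm.neg p) (ITerm.neg p')
  | congr_and {p p' q q' : ITerm} : DerivLI p p' → DerivLI q q' →
      DerivLI (ITerm.and p q) (ITerm.and p' q')
  | congr_or {p p' q q' : ITerm} : DerivLI p p' → DerivLI q q' →
      DerivLI (ITerm.or p q) (ITerm.or p' q')
  | congr_iff {p p' q q' : ITerm} : DerivLI p p' → DerivLI q q' →
      DerivLI (ITerm.iff p q) (ITerm.iff p' q')
  | ax_or (x y : ITerm) :
      DerivLI (ITerm.or x y) (ITerm.neg (ITerm.and (ITerm.neg x) (ITerm.neg y)))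
  | ax_abs (x y : ITerm) : DerivLI (ITerm.and x (ITerm.or x y)) x
  | ax_assoc (x y z : ITerm) :
      DerivLI (ITerm.and (ITerm.and x y) z) (ITerm.and x (ITerm.and y z))
  | ax_tx (x : ITerm) : DerivLI (ITerm.iff ITerm.T x) x
  | ax_xf (x : ITerm) : DerivLI (ITerm.iff x ITerm.F) (ITerm.neg x)
  | ax_andiff (x y z : ITerm) :
      DerivLI (ITerm.iff (ITerm.and x y) z)
              (ITerm.or (ITerm.and x (ITerm.iff y z))
                        (ITerm.and (ITerm.neg x) (ITerm.neg z)))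

/-- Algebras satisfying EqMSCLℓI, with disjunction eliminated by means of (Or). -/
class MSCLIAlgebra (α : Type*) where
  tt : α
  ff : α
  neg : α → α
  conj : α → α → α
  iff : α → α → α
  conj_neg_conj_neg (x y : α) : conj x (neg (conj (neg x) (neg y))) = x
  conj_assoc (x y z : α) : conj (conj x y) z = conj x (conj y z)
  tt_iff (x : α) : iff tt x = x
  iff_ff (x : α) : iff x ff = neg x
  conj_iff (x y z : α) : iff (conj x y) z =
    neg (conj (neg (conj x (iff y z))) (neg (conj (neg x) (neg z))))

namespace MSCLIAlgebra

local prefix:max "∼" => MSCLIAlgebra.neg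
local infixr:70 " ⋏ " => MSCLIAlgebra.conj
local infix:60 " ⇔ " => MSCLIAlgebra.iff
local notation "𝐓" => MSCLIAlgebra.tt
local notation "𝐅" => MSCLIAlgebra.ff

variable {α : Type*} [MSCLIAlgebra α]

theorem neg_tt : ∼(𝐓 : α) = 𝐅 := by
  rw [← iff_ff, tt_iff]

theorem conj_neg_neg (x : α) : x ⋏ ∼∼x = x := by
  have h := conj_neg_conj_neg x (∼∼x ⋏ ∼x)
  rwa [conj_neg_conj_neg (∼x) x] at h

theorem exists_eq_neg (x : α) : ∃ w, x = ∼w := by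
  have h := conj_iff 𝐓 (∼(∼𝐓 ⋏ ∼𝐓)) x
  rw [conj_neg_conj_neg, tt_iff] at h
  exact ⟨_, h⟩

theorem conj_neg_neg_conj (x y : α) : x ⋏ ∼(∼x ⋏ y) = x := by
  obtain ⟨w, rfl⟩ := exists_eq_neg y
  exact conj_neg_conj_neg x w

theorem neg_conj (x y : α) : ∼(x ⋏ y) = ∼(∼(x ⋏ ∼y) ⋏ ∼(∼x ⋏ ∼𝐅)) := by
  rw [← iff_ff, conj_iff, iff_ff]

theorem neg_conj_congr_right (x : α) {y z : α} (h : ∼y = ∼z) : ∼(x ⋏ y) = ∼(x ⋏ z) := by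
  rw [neg_conj, h, ← neg_conj]

theorem conj_neg_neg_neg_neg (x : α) : x ⋏ ∼∼∼∼x = x := by
  calc x ⋏ ∼∼∼∼x = (x ⋏ ∼∼x) ⋏ ∼∼∼∼x := by rw [conj_neg_neg]
    _ = x := by rw [conj_assoc, conj_neg_neg, conj_neg_neg]

theorem neg_conj_neg (x : α) : ∼(x ⋏ ∼x) = ∼(∼x ⋏ ∼(∼x ⋏ ∼𝐅)) := by
  rw [neg_conj, conj_neg_neg]

theorem neg_conj_self (x : α) : ∼(x ⋏ x) = ∼x := by
  have h : ∼(x ⋏ ∼∼∼x) = ∼(x ⋏ ∼x) := by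
    rw [neg_conj, conj_neg_neg_neg_neg, ← neg_conj_neg]
  rw [neg_conj, ← h, ← neg_conj, conj_neg_neg]

theorem conj_neg_conj_self_neg (x : α) : x ⋏ ∼(x ⋏ ∼x) = x := by
  rw [neg_conj_neg, conj_neg_neg_conj]

theorem tt_conj_neg_ff_conj (x : α) : 𝐓 ⋏ ∼(𝐅 ⋏ x) = (𝐓 : α) := by
  rw [← neg_tt, conj_neg_neg_conj]

theorem tt_conj_neg_ff : 𝐓 ⋏ ∼𝐅 = (𝐓 : α) := by
  rw [← neg_tt, conj_neg_neg]

theorem neg_tt_conj_of_tt_conj_neg {x : α} (h : 𝐓 ⋏ ∼x = 𝐓) : ∼(𝐓 ⋏ x) = ∼𝐅 := by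
  rw [neg_conj, h, neg_tt, conj_neg_conj_self_neg]

theorem neg_tt_conj_ff : ∼(𝐓 ⋏ 𝐅) = ∼(𝐅 : α) :=
  neg_tt_conj_of_tt_conj_neg tt_conj_neg_ff

theorem neg_tt_conj_ff_conj (x : α) : ∼(𝐓 ⋏ 𝐅 ⋏ x) = ∼𝐅 :=
  neg_tt_conj_of_tt_conj_neg (tt_conj_neg_ff_conj x)

theorem neg_neg_ff_conj_neg_neg_ff : ∼(∼𝐅 ⋏ ∼∼𝐅) = ∼(𝐅 : α) := by
  have h := neg_conj (𝐓 ⋏ 𝐅 ⋏ 𝐓 : α) 𝐓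
  simpa only [conj_assoc, neg_tt_conj_ff_conj, neg_conj_self] using h.symm

theorem ff_conj_neg_ff : 𝐅 ⋏ ∼𝐅 = (𝐅 : α) := by
  rw [← neg_neg_ff_conj_neg_neg_ff, conj_neg_neg_conj]

theorem neg_neg_ff : ∼∼𝐅 = (𝐅 : α) := by
  have h := neg_conj (𝐓 : α) 𝐓
  simpa only [neg_tt, neg_conj_self, neg_tt_conj_ff, ff_conj_neg_ff] using h.symm

theorem neg_conj_neg_ff (x : α) : ∼(x ⋏ ∼𝐅) = ∼(x ⋏ 𝐓) :=
  neg_conj_congr_right x (by rw [neg_neg_ff, neg_tt])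

theorem ff_conj_ff : 𝐅 ⋏ 𝐅 = (𝐅 : α) := by
  simpa only [neg_neg_ff] using conj_neg_neg (𝐅 : α)

theorem exists_tt_eq_neg_conj_tt : ∃ q : α, 𝐓 = ∼(q ⋏ 𝐓) := by
  have h := conj_iff (𝐓 : α) (∼𝐅) 𝐓
  rw [tt_conj_neg_ff, tt_iff, neg_tt, ff_conj_ff, neg_conj_neg_ff] at h
  exact ⟨_, h⟩

theorem neg_ff : ∼𝐅 = (𝐓 : α) := by
  obtain ⟨q, hq⟩ := exists_tt_eq_neg_conj_tt (α := α)
  set r := q ⋏ 𝐓 with hr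
  calc ∼𝐅 = ∼(𝐓 ⋏ ∼𝐓) := by rw [neg_tt, neg_tt_conj_ff]
    _ = ∼(𝐓 ⋏ ∼(𝐓 ⋏ 𝐓)) := by rw [neg_conj_self]
    _ = ∼(∼r ⋏ ∼(∼r ⋏ 𝐓)) := by rw [← hq]
    _ = ∼(r ⋏ ∼r) := by rw [← neg_conj_neg_ff (∼r), ← neg_conj_neg]
    _ = ∼(q ⋏ 𝐓 ⋏ 𝐓) := by rw [← hq, hr, conj_assoc]
    _ = ∼r := neg_conj_congr_right q (neg_conj_self 𝐓)
    _ = 𝐓 := hq.symm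

theorem tt_conj_tt : 𝐓 ⋏ 𝐓 = (𝐓 : α) := by
  simpa only [neg_ff] using tt_conj_neg_ff (α := α)

theorem eq_neg_conj_neg_ff_conj (x : α) : x = ∼(∼(𝐓 ⋏ x) ⋏ ∼(𝐅 ⋏ ∼x)) := by
  simpa only [tt_conj_tt, tt_iff, neg_tt] using conj_iff 𝐓 𝐓 x

theorem ff_conj_neg_ff_conj (x : α) : 𝐅 ⋏ ∼(𝐅 ⋏ x) = 𝐅 := by
  have h : 𝐅 ⋏ ∼(∼𝐅 ⋏ 𝐅) = (𝐅 : α) := conj_neg_neg_conj 𝐅 𝐅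
  have h' : ∼(∼𝐅 ⋏ 𝐅) = (𝐓 : α) := by rw [neg_ff, neg_tt_conj_ff, neg_ff]
  calc 𝐅 ⋏ ∼(𝐅 ⋏ x) = (𝐅 ⋏ 𝐓) ⋏ ∼(∼𝐓 ⋏ x) := by rw [neg_tt, ← h', h]
    _ = 𝐅 := by rw [conj_assoc, conj_neg_neg_conj, ← h', h]

theorem ff_conj (x : α) : 𝐅 ⋏ x = 𝐅 := by
  rw [eq_neg_conj_neg_ff_conj (𝐅 ⋏ x), neg_tt_conj_ff_conj, ff_conj_neg_ff_conj, neg_ff,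
    tt_conj_tt, neg_tt]

theorem neg_tt_conj (x : α) : ∼(𝐓 ⋏ x) = ∼x := by
  have h := eq_neg_conj_neg_ff_conj (∼x)
  rw [ff_conj] at h
  rw [neg_conj, neg_tt, ff_conj, ← h]

theorem neg_neg_conj_tt (x : α) : ∼(∼x ⋏ 𝐓) = x := by
  conv_rhs => rw [eq_neg_conj_neg_ff_conj x, neg_tt_conj, ff_conj, neg_ff]

theorem conj_self (x : α) : x ⋏ x = x := by
  conv_lhs => rw [← neg_neg_conj_tt x]
  conv_rhs => rw [← conj_neg_neg_conj x 𝐓]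
  rw [neg_neg_conj_tt]

theorem neg_neg_conj_neg_conj (x y : α) : ∼(∼(x ⋏ ∼y) ⋏ x) = ∼(x ⋏ y) := by
  rw [neg_conj x y, neg_ff, neg_neg_conj_tt]

theorem tt_conj (x : α) : 𝐓 ⋏ x = x := by
  obtain ⟨w, rfl⟩ := exists_eq_neg x
  rw [← neg_neg_conj_tt (𝐓 ⋏ ∼w), neg_neg_conj_neg_conj, neg_tt_conj]

theorem conj_tt (x : α) : x ⋏ 𝐓 = x := by
  have h : (∼∼x ⋏ 𝐓) ⋏ ∼(∼x ⋏ 𝐓) = ∼∼x ⋏ 𝐓 := by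
    simpa only [neg_neg_conj_tt] using conj_neg_neg_conj (∼∼x ⋏ 𝐓) 𝐓
  rw [conj_assoc, tt_conj, neg_neg_conj_tt] at h
  calc x ⋏ 𝐓 = (x ⋏ ∼∼x) ⋏ 𝐓 := by rw [conj_neg_neg]
    _ = (x ⋏ ∼∼x) ⋏ x := by rw [conj_assoc, ← h, ← conj_assoc]
    _ = x := by rw [conj_neg_neg, conj_self]

theorem neg_neg (x : α) : ∼∼x = x := by
  simpa only [conj_tt] using neg_neg_conj_tt x

theorem neg_conj_neg_conj (x y : α) : ∼x ⋏ ∼(x ⋏ y) = ∼x := by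
  simpa only [neg_neg] using conj_neg_neg_conj (∼x) y

theorem neg_conj_conj_left (x y : α) : ∼(x ⋏ y) ⋏ x = x ⋏ ∼y := by
  have h := congrArg neg (neg_neg_conj_neg_conj x (∼y))
  simpa only [neg_neg] using h

theorem neg_conj_conj_conj (x y z : α) : ∼(x ⋏ y) ⋏ x ⋏ z = x ⋏ ∼y ⋏ z := by
  rw [← conj_assoc, neg_conj_conj_left, conj_assoc]

theorem conj_neg_conj (x y : α) : x ⋏ ∼(x ⋏ y) = x ⋏ ∼y := by
  rw [← neg_conj_conj_left, ← conj_assoc, conj_self, neg_conj_conj_left]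

theorem neg_conj_eq_conj_ff (x : α) : ∼x ⋏ x = x ⋏ 𝐅 := by
  simpa only [conj_tt, neg_tt] using neg_conj_conj_left x 𝐓

theorem neg_conj_ff (x : α) : ∼x ⋏ 𝐅 = x ⋏ 𝐅 := by
  have h : x ⋏ ∼x = ∼x ⋏ 𝐅 := by
    simpa only [neg_neg] using neg_conj_eq_conj_ff (∼x)
  calc ∼x ⋏ 𝐅 = (x ⋏ ∼x) ⋏ (x ⋏ ∼x) := by rw [conj_self, h]
    _ = x ⋏ (∼x ⋏ x) ⋏ ∼x := by simp only [conj_assoc]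
    _ = (x ⋏ x) ⋏ 𝐅 ⋏ ∼x := by rw [neg_conj_eq_conj_ff, conj_assoc, conj_assoc]
    _ = x ⋏ 𝐅 := by rw [conj_self, ff_conj]

theorem neg_conj_conj_neg_conj_ff (x y : α) : ∼(x ⋏ y) ⋏ ∼(x ⋏ 𝐅) = ∼(x ⋏ y) := by
  rw [← conj_neg_conj, neg_conj_conj_conj, neg_conj_ff, ← conj_assoc, neg_conj_neg_conj]

theorem neg_conj_ff_conj_neg (x y : α) : ∼(x ⋏ 𝐅) ⋏ ∼y = ∼(∼(x ⋏ 𝐅) ⋏ y) := by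
  have h : ∼(x ⋏ 𝐅) = ∼(∼(x ⋏ 𝐅) ⋏ 𝐅) := by rw [neg_conj_ff, conj_assoc, ff_conj]
  calc ∼(x ⋏ 𝐅) ⋏ ∼y = ∼(∼(x ⋏ 𝐅) ⋏ y) ⋏ ∼(x ⋏ 𝐅) := (neg_conj_conj_left _ _).symm
    _ = ∼(∼(x ⋏ 𝐅) ⋏ y) ⋏ ∼(∼(x ⋏ 𝐅) ⋏ 𝐅) := by rw [← h]
    _ = ∼(∼(x ⋏ 𝐅) ⋏ y) := neg_conj_conj_neg_conj_ff _ _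

theorem iff_eq (x y : α) : x ⇔ y = ∼(∼(x ⋏ y) ⋏ ∼(∼x ⋏ ∼y)) := by
  simpa only [conj_tt, tt_iff] using conj_iff x 𝐓 y

/-- Both sides are `(x ∧ F) ↔ ¬z`, up to simplification. -/
theorem neg_conj_ff_conj (x z : α) : ∼(x ⋏ 𝐅) ⋏ z = ∼(∼(x ⋏ z) ⋏ ∼(∼x ⋏ z)) := by
  have h := conj_iff x 𝐅 (∼z)
  simp only [iff_eq, neg_neg, neg_ff, ff_conj, tt_conj, conj_assoc] at h
  rw [← h, conj_neg_conj, ← neg_conj_ff_conj_neg]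
  simp only [neg_neg]

theorem neg_conj_ff_conj_neg_conj (x y : α) : ∼(x ⋏ 𝐅) ⋏ ∼(x ⋏ y) = ∼(x ⋏ y) := by
  rw [neg_conj_ff_conj_neg, neg_conj_conj_conj, neg_ff, tt_conj]

/-- The axiom (Mem), with disjunction eliminated. -/
theorem neg_conj_conj (x y z : α) :
    ∼(∼x ⋏ ∼y) ⋏ z = ∼(∼(∼x ⋏ y ⋏ z) ⋏ ∼(x ⋏ z)) := by
  have h := neg_conj_ff_conj (∼x) (∼(∼x ⋏ ∼y) ⋏ z)
  rwa [← conj_assoc, neg_conj_ff_conj_neg_conj, ← conj_assoc, conj_neg_conj, neg_neg, neg_neg,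
    conj_assoc, ← conj_assoc x, conj_neg_neg_conj] at h

end MSCLIAlgebra

namespace ITerm

/-- Derivable equality as a setoid on terms. -/
def derivSetoid : Setoid ITerm :=
  ⟨DerivLI, DerivLI.refl, DerivLI.symm, DerivLI.trans⟩

/-- The Lindenbaum algebra of EqMSCLℓI. -/
instance : MSCLIAlgebra (Quotient derivSetoid) where
  tt := Quotient.mk _ T
  ff := Quotient.mk _ F
  neg := Quotient.map neg fun _ _ => DerivLI.congr_neg
  conj := Quotient.map₂ and fun _ _ h _ _ => DerivLI.congr_and h
  iff := Quotient.map₂ iff fun _ _ h _ _ => DerivLI.congr_iff h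
  conj_neg_conj_neg := by
    rintro ⟨x⟩ ⟨y⟩
    exact Quotient.sound
      (((DerivLI.refl x).congr_and (DerivLI.ax_or x y).symm).trans (DerivLI.ax_abs x y))
  conj_assoc := by
    rintro ⟨x⟩ ⟨y⟩ ⟨z⟩
    exact Quotient.sound (DerivLI.ax_assoc x y z)
  tt_iff := by
    rintro ⟨x⟩
    exact Quotient.sound (DerivLI.ax_tx x)
  iff_ff := by
    rintro ⟨x⟩
    exact Quotient.sound (DerivLI.ax_xf x)
  conj_iff := by
    rintro ⟨x⟩ ⟨y⟩ ⟨z⟩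
    exact Quotient.sound ((DerivLI.ax_andiff x y z).trans (DerivLI.ax_or _ _))

end ITerm

/-- Every axiom of EqMSCL is derivable in EqMSCLℓI: (Neg), (Or), (Tand), (Abs), (Mem). -/
theorem eqmscl_derivable_in_eqmscl_li :
    (DerivLI ITerm.F (ITerm.neg ITerm.T)) ∧
    (∀ x y : ITerm, DerivLI (ITerm.or x y)
        (ITerm.neg (ITerm.and (ITerm.neg x) (ITerm.neg y)))) ∧
    (∀ x : ITerm, DerivLI (ITerm.and ITerm.T x) x) ∧
    (∀ x y : ITerm, DerivLI (ITerm.and x (ITerm.or x y)) x) ∧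
    (∀ x y z : ITerm, DerivLI (ITerm.and (ITerm.or x y) z)
        (ITerm.or (ITerm.and (ITerm.neg x) (ITerm.and y z)) (ITerm.and x z))) := by
  let q : ITerm → Quotient ITerm.derivSetoid := Quotient.mk _
  refine ⟨?_, DerivLI.ax_or, fun x => ?_, DerivLI.ax_abs, fun x y z => ?_⟩
  · exact Quotient.exact (MSCLIAlgebra.neg_tt (α := Quotient ITerm.derivSetoid)).symm
  · exact Quotient.exact (MSCLIAlgebra.tt_conj (q x))
  · exact ((DerivLI.ax_or x y).congr_and (DerivLI.refl z)).trans
      ((Quotient.exact (MSCLIAlgebra.neg_conj_conj (q x) (q y) (q z))).trans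
        (DerivLI.ax_or _ _).symm)
end

section
/- The left-sequential biconditional is associative in EqMSCLℓI: EqMSCLℓI ⊢ (x ↔❛ y) ↔❛ z = x ↔❛ (y ↔❛ z). Moreover EqMSCLℓI ⊢ ¬(x ↔❛ y) = x ↔❛ ¬y and EqMSCLℓI ⊢ ¬x ↔❛ ¬y = x ↔❛ y. -/
/-- Algebras for the signature of left-sequential connectives satisfying the axioms of
EqMSCLℓI. -/
class LeftSeqAlgebra (α : Type*) where
  T : α
  F : α
  neg : α → α
  and : α → α → α
  or : α → α → α
  iff : α → α → α
  or_def (x y : α) : or x y = neg (and (neg x) (neg y))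
  and_or_self (x y : α) : and x (or x y) = x
  and_assoc (x y z : α) : and (and x y) z = and x (and y z)
  T_iff (x : α) : iff T x = x
  iff_F (x : α) : iff x F = neg x
  and_iff (x y z : α) : iff (and x y) z = or (and x (iff y z)) (and (neg x) (neg z))

namespace LeftSeqAlgebra

local prefix:max "∼" => LeftSeqAlgebra.neg
local infixr:70 " ⋏ " => LeftSeqAlgebra.and
local infix:60 " ⇔ " => LeftSeqAlgebra.iff

variable {α : Type*} [LeftSeqAlgebra α]

theorem neg_T : (∼T : α) = F := by
  rw [← iff_F, T_iff]

theorem and_neg_neg_and_neg (x y : α) : x ⋏ ∼(∼x ⋏ ∼y) = x := by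
  rw [← or_def, and_or_self]

theorem and_neg_neg_self (x : α) : x ⋏ ∼∼x = x := by
  rw [← and_neg_neg_and_neg (∼x) T, and_neg_neg_and_neg x (∼∼x ⋏ ∼T)]

theorem T_and_neg_F : (T ⋏ ∼F : α) = T := by
  rw [← neg_T, and_neg_neg_self]

theorem neg_cond_iff (x y z : α) : ∼(∼(x ⋏ (y ⇔ z)) ⋏ ∼(∼x ⋏ ∼z)) = x ⋏ y ⇔ z := by
  rw [← or_def (x ⋏ (y ⇔ z)) (∼x ⋏ ∼z), ← and_iff]

theorem neg_and_expand (x y : α) : ∼(∼(x ⋏ ∼y) ⋏ ∼(∼x ⋏ ∼F)) = ∼(x ⋏ y) := by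
  rw [← iff_F y, neg_cond_iff, iff_F]

theorem neg_F_and_neg_F_and_neg_F : (∼(F ⋏ ∼(F ⋏ ∼F)) : α) = ∼(T ⋏ F) := by
  calc
    (∼(F ⋏ ∼(F ⋏ ∼F)) : α)
    _ = ∼(F ⋏ ∼(∼T ⋏ ∼F)) := by rw [neg_T]
    _ = ∼(∼(T ⋏ ∼F) ⋏ ∼(∼T ⋏ ∼F)) := by rw [T_and_neg_F, neg_T]
    _ = ∼(T ⋏ F) := by rw [neg_and_expand]

theorem and_iff_and_and_iff (x y z : α) : x ⋏ (y ⇔ z) ⋏ (x ⋏ y ⇔ z) = x ⋏ (y ⇔ z) := by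
  rw [← and_assoc, ← neg_cond_iff, and_neg_neg_and_neg]

theorem and_neg_and_neg_and (x y : α) : x ⋏ ∼y ⋏ ∼(x ⋏ y) = x ⋏ ∼y := by
  rw [← iff_F (x ⋏ y), ← iff_F, and_iff_and_and_iff, iff_F]

theorem and_neg_and_neg_self (x : α) : x ⋏ ∼(x ⋏ ∼x) = x := by
  calc
    x ⋏ ∼(x ⋏ ∼x)
    _ = (x ⋏ ∼∼x) ⋏ ∼(x ⋏ ∼x) := by rw [and_neg_neg_self]
    _ = x := by rw [and_assoc, and_neg_and_neg_and, and_neg_neg_self]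

theorem and_neg_neg_and (x y : α) : x ⋏ ∼(∼x ⋏ y) = x := by
  rw [← T_iff y, ← T_and_neg_F, ← neg_cond_iff, and_neg_neg_and_neg]

theorem T_and_neg_F_and (x : α) : T ⋏ ∼(F ⋏ x) = T := by
  rw [← neg_T, and_neg_neg_and]

theorem T_and_neg_T_and_F_and (x : α) : T ⋏ ∼(T ⋏ F ⋏ x) = T := by
  calc
    T ⋏ ∼(T ⋏ F ⋏ x)
    _ = (T ⋏ ∼(F ⋏ x)) ⋏ ∼(T ⋏ F ⋏ x) := by rw [T_and_neg_F_and]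
    _ = T := by rw [and_assoc, and_neg_and_neg_and, T_and_neg_F_and]

theorem neg_T_and_T_and_F_and (x : α) : ∼(T ⋏ T ⋏ F ⋏ x) = ∼F := by
  calc
    ∼(T ⋏ T ⋏ F ⋏ x)
    _ = ∼(F ⋏ ∼(∼T ⋏ ∼F)) := by rw [← neg_and_expand T (T ⋏ F ⋏ x), T_and_neg_T_and_F_and, neg_T]
    _ = ∼F := by rw [neg_T, and_neg_and_neg_self]

theorem neg_neg_F_and_neg_idem : (∼(∼F ⋏ ∼(∼F ⋏ ∼F)) : α) = ∼F := by
  calc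
    (∼(∼F ⋏ ∼(∼F ⋏ ∼F)) : α)
    _ = ∼(∼((T ⋏ T ⋏ F ⋏ T) ⋏ ∼T) ⋏ ∼(∼(T ⋏ T ⋏ F ⋏ T) ⋏ ∼F)) := by
      rw [neg_T_and_T_and_F_and, and_assoc, and_assoc, and_assoc, neg_T_and_T_and_F_and]
    _ = ∼F := by rw [neg_and_expand, and_assoc, and_assoc, and_assoc, neg_T_and_T_and_F_and]

theorem F_and_neg_F : (F ⋏ ∼F : α) = F := by
  rw [← neg_neg_F_and_neg_idem, and_neg_neg_and]

theorem T_and_neg_F_and_left (x : α) : T ⋏ ∼F ⋏ x = T ⋏ x := by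
  rw [← and_assoc, T_and_neg_F]

theorem neg_T_and_neg_neg_F : (∼(T ⋏ ∼∼F) : α) = ∼F := by
  calc
    (∼(T ⋏ ∼∼F) : α)
    _ = ∼(∼T ⋏ ∼(∼T ⋏ ∼F)) := by
      rw [← T_and_neg_F_and_left, ← neg_and_expand T (∼F ⋏ ∼∼F), ← T_and_neg_F_and_left,
        and_neg_and_neg_self, T_and_neg_F]
    _ = ∼(F ⋏ ∼(∼T ⋏ ∼F)) := by rw [neg_T]
    _ = ∼F := by rw [neg_T, and_neg_and_neg_self]

theorem neg_neg_F_and_neg_F_and : (∼(∼F ⋏ ∼(F ⋏ ∼F)) : α) = F := by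
  calc
    (∼(∼F ⋏ ∼(F ⋏ ∼F)) : α)
    _ = ∼(∼(T ⋏ ∼∼F) ⋏ ∼(∼T ⋏ ∼F)) := by rw [neg_T, neg_T_and_neg_neg_F]
    _ = F := by rw [neg_and_expand, T_and_neg_F, neg_T]

theorem neg_neg_F_and_neg_F : (∼(∼F ⋏ ∼F) : α) = F := by
  calc
    (∼(∼F ⋏ ∼F) : α)
    _ = ∼(∼F ⋏ ∼(F ⋏ ∼F)) := by rw [F_and_neg_F]
    _ = F := by rw [neg_neg_F_and_neg_F_and]

theorem and_neg_neg_and_and (x y z : α) : x ⋏ ∼(∼x ⋏ y) ⋏ z = x ⋏ z := by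
  rw [← and_assoc, and_neg_neg_and]

theorem and_neg_and_neg_self_and (x y : α) : x ⋏ ∼(x ⋏ ∼x) ⋏ y = x ⋏ y := by
  rw [← and_assoc, and_neg_and_neg_self]

theorem neg_expand_absorb (x y z : α) :
    ∼(x ⋏ ∼y) ⋏ ∼(∼x ⋏ ∼F) ⋏ ∼(∼(x ⋏ y) ⋏ ∼z) = ∼(x ⋏ ∼y) ⋏ ∼(∼x ⋏ ∼F) := by
  calc
    ∼(x ⋏ ∼y) ⋏ ∼(∼x ⋏ ∼F) ⋏ ∼(∼(x ⋏ y) ⋏ ∼z)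
    _ = ∼(x ⋏ (y ⇔ F)) ⋏ ∼(∼x ⋏ ∼F) := by
      rw [← iff_F (x ⋏ y), ← iff_F y, ← and_assoc, ← neg_cond_iff, and_neg_neg_and_neg]
    _ = ∼(x ⋏ ∼y) ⋏ ∼(∼x ⋏ ∼F) := by rw [iff_F]

theorem and_neg_neg_idem_and (x y : α) : x ⋏ ∼(∼(x ⋏ x) ⋏ ∼y) = x := by
  rw [← and_neg_neg_and_and x (∼F) (∼(∼(x ⋏ x) ⋏ ∼y)),
    ← and_neg_and_neg_self_and x (∼(∼x ⋏ ∼F) ⋏ ∼(∼(x ⋏ x) ⋏ ∼y)), neg_expand_absorb,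
    and_neg_and_neg_self_and, and_neg_neg_and]

theorem neg_F_and_neg_F : (∼F ⋏ ∼F : α) = ∼F := by
  calc
    (∼F ⋏ ∼F : α)
    _ = ∼F ⋏ ∼(∼(∼F ⋏ ∼F) ⋏ ∼∼∼(∼F ⋏ ∼F)) := by rw [and_neg_neg_self, neg_neg_F_and_neg_F]
    _ = ∼F := by rw [and_neg_neg_idem_and]

theorem neg_neg_F : (∼∼F : α) = F := by
  rw [← neg_F_and_neg_F, neg_neg_F_and_neg_F]

theorem neg_cond_eq_and_T_iff (x y : α) : ∼(∼(x ⋏ y) ⋏ ∼(∼x ⋏ ∼y)) = x ⋏ T ⇔ y := by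
  calc
    ∼(∼(x ⋏ y) ⋏ ∼(∼x ⋏ ∼y))
    _ = ∼(∼(x ⋏ (T ⇔ y)) ⋏ ∼(∼x ⋏ ∼y)) := by rw [T_iff]
    _ = x ⋏ T ⇔ y := by rw [neg_cond_iff]

theorem neg_and_neg_F (x : α) : ∼(x ⋏ ∼F) = ∼(x ⋏ T) := by
  rw [← neg_and_expand x (∼F), neg_neg_F, neg_cond_eq_and_T_iff, iff_F]

theorem F_and_F_and (x : α) : F ⋏ F ⋏ x = F ⋏ x := by
  calc
    F ⋏ F ⋏ x
    _ = F ⋏ ∼(∼F ⋏ ∼(F ⋏ ∼F)) ⋏ x := by rw [neg_neg_F_and_neg_F_and]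
    _ = F ⋏ x := by rw [and_neg_neg_and_and]

theorem neg_and_expand_T (x y : α) : ∼(∼(x ⋏ ∼y) ⋏ ∼(∼x ⋏ T)) = ∼(x ⋏ y) := by
  rw [← neg_and_neg_F, neg_and_expand]

theorem F_and_F : (F ⋏ F : α) = F := by
  calc
    (F ⋏ F : α)
    _ = F ⋏ ∼(∼F ⋏ ∼(F ⋏ ∼F)) := by rw [neg_neg_F_and_neg_F_and]
    _ = F := by rw [and_neg_neg_and]

theorem F_and_neg_F_and_T : (F ⋏ ∼(F ⋏ T) : α) = F := by
  calc
    (F ⋏ ∼(F ⋏ T) : α)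
    _ = F ⋏ (T ⇔ F) ⋏ (F ⋏ T ⇔ F) := by rw [T_iff, F_and_F_and, iff_F]
    _ = F := by rw [and_iff_and_and_iff, T_iff, F_and_F]

theorem F_and_neg_neg_neg_F_and_T_and (x : α) : F ⋏ ∼(∼∼(F ⋏ T) ⋏ x) = F := by
  calc
    F ⋏ ∼(∼∼(F ⋏ T) ⋏ x)
    _ = (F ⋏ ∼(F ⋏ T)) ⋏ ∼(∼∼(F ⋏ T) ⋏ x) := by rw [F_and_neg_F_and_T]
    _ = F := by rw [and_assoc, and_neg_neg_and, F_and_neg_F_and_T]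

theorem F_and_neg_F_and (x : α) : F ⋏ ∼(F ⋏ x) = F := by
  calc
    F ⋏ ∼(F ⋏ x)
    _ = F ⋏ ∼(∼∼(F ⋏ ∼F) ⋏ x) := by rw [F_and_neg_F, neg_neg_F]
    _ = F := by rw [neg_and_neg_F, F_and_neg_neg_neg_F_and_T_and]

theorem neg_neg_F_and_F : (∼(∼F ⋏ F) : α) = ∼F := by
  calc
    (∼(∼F ⋏ F) : α)
    _ = ∼(∼F ⋏ ∼(∼F ⋏ ∼F)) := by rw [neg_neg_F_and_neg_F]
    _ = ∼F := by rw [neg_neg_F_and_neg_idem]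

theorem neg_neg_F_and_T : (∼(∼F ⋏ T) : α) = F := by
  calc
    (∼(∼F ⋏ T) : α)
    _ = ∼(∼F ⋏ ∼F) := by
      rw [← iff_F (∼F ⋏ T), ← neg_cond_eq_and_T_iff, neg_neg_F_and_F, neg_neg_F, F_and_neg_F]
    _ = F := by rw [neg_F_and_neg_F, neg_neg_F]

theorem neg_F_and (x : α) : ∼(F ⋏ x) = ∼F := by
  rw [← F_and_F_and, ← neg_and_expand_T, F_and_neg_F_and, neg_neg_F_and_T, neg_neg_F_and_F]

theorem neg_cond_and_iff (x y z u : α) :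
    ∼(∼(x ⋏ y ⋏ (z ⇔ u)) ⋏ ∼(∼(x ⋏ y) ⋏ ∼u)) = x ⋏ y ⋏ z ⇔ u := by
  rw [← and_assoc x y (z ⇔ u), neg_cond_iff, and_assoc]

theorem neg_and_and_expand_T (x y z : α) : ∼(∼(x ⋏ y ⋏ ∼z) ⋏ ∼(∼(x ⋏ y) ⋏ T)) = ∼(x ⋏ y ⋏ z) := by
  rw [← neg_and_neg_F, ← iff_F z, neg_cond_and_iff, iff_F]

theorem neg_expand_and_F_and (x y z : α) :
    ∼(∼(x ⋏ y ⋏ T) ⋏ ∼(∼(x ⋏ y) ⋏ T)) = ∼(x ⋏ y ⋏ F ⋏ z) := by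
  rw [← and_assoc x y T, ← neg_and_neg_F (x ⋏ y), and_assoc, ← neg_F_and z, neg_and_and_expand_T]

theorem neg_neg_T_and_and_T (x : α) : ∼(∼(T ⋏ x) ⋏ T) = T ⋏ T ⇔ x := by
  rw [← neg_and_neg_F, ← neg_F_and (∼x), ← neg_T, neg_cond_eq_and_T_iff]

theorem neg_neg_T_and_iff_and_T (x y : α) : ∼(∼(T ⋏ (x ⇔ y)) ⋏ T) = T ⋏ x ⇔ y := by
  rw [← neg_and_neg_F, ← neg_F_and (∼y), ← neg_T, neg_cond_iff]

theorem T_and_T_iff_iff (x y : α) : T ⋏ T ⇔ (x ⇔ y) = T ⋏ x ⇔ y := by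
  rw [← neg_neg_T_and_and_T, neg_neg_T_and_iff_and_T]

theorem neg_T_and_neg_F_iff_T_and_F_and (x : α) : ∼(T ⋏ (∼F ⇔ T) ⋏ F ⋏ x) = T := by
  calc
    ∼(T ⋏ (∼F ⇔ T) ⋏ F ⋏ x)
    _ = ∼(∼(T ⋏ (∼F ⇔ T) ⋏ (T ⋏ ∼F ⇔ T)) ⋏ ∼(∼(T ⋏ (∼F ⇔ T)) ⋏ T)) := by
      rw [T_and_neg_F, T_iff, neg_expand_and_F_and T (∼F ⇔ T) x]
    _ = T := by
      rw [and_iff_and_and_iff, neg_neg_T_and_and_T, T_and_T_iff_iff, T_and_neg_F, T_iff,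
        neg_neg_T_and_and_T, T_and_T_iff_iff, T_and_neg_F, T_iff]

theorem neg_F : (∼F : α) = T := by
  calc
    (∼F : α)
    _ = ∼(T ⋏ ∼T) := by rw [← and_neg_and_neg_self F, neg_F_and_neg_F_and_neg_F, ← neg_T]
    _ = ∼(∼((T ⋏ (∼F ⇔ T) ⋏ F ⋏ T) ⋏ (T ⇔ F)) ⋏ ∼∼(T ⋏ (∼F ⇔ T) ⋏ F ⋏ T)) := by
      rw [iff_F, and_assoc, and_assoc, and_assoc, neg_T_and_neg_F_iff_T_and_F_and (T ⋏ ∼T),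
        neg_T_and_neg_F_iff_T_and_F_and]
    _ = ∼(∼((T ⋏ (∼F ⇔ T) ⋏ F ⋏ T) ⋏ (T ⇔ ∼∼(T ⋏ (∼F ⇔ T) ⋏ F ⋏ T))) ⋏ ∼(∼(T ⋏ (∼F ⇔ T) ⋏ F ⋏ T) ⋏ ∼∼∼(T ⋏ (∼F ⇔ T) ⋏ F ⋏ T))) := by
      rw [and_neg_neg_self, neg_T_and_neg_F_iff_T_and_F_and, neg_T]
    _ = T := by
      rw [neg_cond_iff, and_assoc, and_assoc, and_assoc, neg_T_and_neg_F_iff_T_and_F_and, neg_T,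
        iff_F, neg_T_and_neg_F_iff_T_and_F_and]

theorem and_neg_neg_and_neg_and (x y z : α) : x ⋏ ∼(∼x ⋏ ∼y) ⋏ z = x ⋏ z := by
  rw [← and_assoc, and_neg_neg_and_neg]

theorem T_and_T : (T ⋏ T : α) = T := by
  calc
    (T ⋏ T : α)
    _ = T ⋏ ∼∼T := by rw [neg_T, neg_F]
    _ = T := by rw [and_neg_neg_self]

theorem neg_F_and_T : (∼(F ⋏ T) : α) = T := by
  calc
    (∼(F ⋏ T) : α)
    _ = ∼(F ⋏ ∼(F ⋏ ∼T)) := by rw [neg_T, F_and_F, neg_F]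
    _ = ∼(F ⋏ ∼(∼T ⋏ ∼T)) := by rw [neg_T]
    _ = ∼(∼(T ⋏ T) ⋏ ∼(∼T ⋏ ∼T)) := by rw [T_and_T, neg_T]
    _ = T := by rw [neg_cond_eq_and_T_iff, T_and_T, T_iff]

theorem neg_T_and_F_and (x : α) : ∼(T ⋏ F ⋏ x) = T := by
  calc
    ∼(T ⋏ F ⋏ x)
    _ = ∼(F ⋏ ∼(∼T ⋏ T)) := by rw [← neg_and_expand_T T (F ⋏ x), T_and_neg_F_and, neg_T]
    _ = T := by rw [neg_T, neg_F_and_T, neg_F_and_T]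

theorem F_and (x : α) : F ⋏ x = F := by
  calc
    F ⋏ x
    _ = ∼(∼(T ⋏ F ⋏ x) ⋏ ∼(∼T ⋏ ∼(F ⋏ x))) := by rw [neg_cond_eq_and_T_iff, T_and_T, T_iff]
    _ = F := by rw [neg_T_and_F_and, neg_T, T_and_neg_F_and, neg_T]

theorem neg_neg_T_and_and_T_eq (x : α) : ∼(∼(T ⋏ x) ⋏ T) = x := by
  calc
    ∼(∼(T ⋏ x) ⋏ T)
    _ = ∼(∼(T ⋏ x) ⋏ ∼(∼T ⋏ ∼x)) := by rw [neg_T, F_and, neg_F]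
    _ = x := by rw [neg_cond_eq_and_T_iff, T_and_T, T_iff]

theorem T_and (x : α) : T ⋏ x = x := by
  calc
    T ⋏ x
    _ = ∼(F ⋏ ∼T) ⋏ x := by rw [F_and, neg_F]
    _ = x := by
      rw [← neg_T, ← neg_neg_T_and_and_T_eq (∼(∼T ⋏ ∼T) ⋏ x), and_neg_neg_and_neg_and,
        neg_neg_T_and_and_T_eq]

theorem neg_neg_and_T (x : α) : ∼(∼x ⋏ T) = x := by
  calc
    ∼(∼x ⋏ T)
    _ = ∼(∼(T ⋏ x) ⋏ T) := by rw [T_and]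
    _ = x := by rw [neg_neg_T_and_and_T_eq]

theorem T_and_and_self (x : α) : T ⋏ x ⋏ x = T ⋏ x := by
  calc
    T ⋏ x ⋏ x
    _ = T ⋏ x ⋏ (T ⇔ x) := by rw [T_iff]
    _ = T ⋏ (T ⇔ x) ⋏ (T ⋏ T ⇔ x) := by rw [T_and_T, T_iff]
    _ = T ⋏ x := by rw [and_iff_and_and_iff, T_iff]

theorem and_self (x : α) : x ⋏ x = x := by
  rw [← T_and (x ⋏ x), T_and_and_self, T_and]

theorem neg_and_T (x : α) : ∼x ⋏ T = ∼x := by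
  rw [← and_neg_neg_self (∼x ⋏ T), neg_neg_and_T, and_assoc, T_and, and_self]

theorem and_T (x : α) : x ⋏ T = x := by
  rw [← and_neg_neg_and_neg_and x T T, neg_and_T, and_neg_neg_and]

theorem neg_neg (x : α) : ∼∼x = x := by
  rw [← neg_and_T x, neg_neg_and_T]

theorem neg_cond_eq_iff (x y : α) : ∼(∼(x ⋏ y) ⋏ ∼(∼x ⋏ ∼y)) = x ⇔ y := by
  rw [neg_cond_eq_and_T_iff, and_T]

theorem neg_neg_and_neg_and_self (x y : α) : ∼(∼(x ⋏ ∼y) ⋏ x) = ∼(x ⋏ y) := by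
  calc
    ∼(∼(x ⋏ ∼y) ⋏ x)
    _ = ∼(∼(x ⋏ (y ⇔ F)) ⋏ ∼(∼x ⋏ ∼F)) := by rw [iff_F, neg_F, and_T, neg_neg]
    _ = ∼(x ⋏ y) := by rw [neg_cond_iff, iff_F]

theorem neg_and_and_self (x y : α) : ∼(x ⋏ y) ⋏ x = x ⋏ ∼y := by
  calc
    ∼(x ⋏ y) ⋏ x
    _ = ∼∼(∼(x ⋏ ∼∼y) ⋏ x) := by rw [neg_neg (∼(x ⋏ ∼∼y) ⋏ x), neg_neg]
    _ = x ⋏ ∼y := by rw [neg_neg_and_neg_and_self, neg_neg]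

theorem neg_and_and_and (x y z : α) : ∼(x ⋏ y) ⋏ x ⋏ z = x ⋏ ∼y ⋏ z := by
  rw [← and_assoc (∼(x ⋏ y)) x z, neg_and_and_self, and_assoc]

theorem and_and_self_right (x y : α) : x ⋏ y ⋏ x = x ⋏ y := by
  rw [← neg_neg y, ← neg_and_and_and, and_self, neg_and_and_self, neg_neg]

theorem and_neg_and_and_self (x y : α) : x ⋏ ∼(y ⋏ x ⋏ y) = x ⋏ ∼y := by
  rw [← neg_and_and_self x (y ⋏ x ⋏ y), ← and_assoc x y (x ⋏ y), and_self, neg_and_and_self]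

theorem and_neg_and_self (x y : α) : x ⋏ ∼(y ⋏ x) = x ⋏ ∼y := by
  rw [← and_and_self_right y x, and_neg_and_and_self]

theorem and_and_self_left (x y : α) : x ⋏ x ⋏ y = x ⋏ y := by
  rw [← and_assoc, and_self]

theorem and_neg_self_and (x y : α) : x ⋏ ∼(x ⋏ y) = x ⋏ ∼y := by
  rw [← neg_and_and_self x (x ⋏ y), and_and_self_left, neg_and_and_self]

theorem and_and_and_left (x y z : α) : x ⋏ y ⋏ x ⋏ z = x ⋏ y ⋏ z := by
  rw [← and_assoc y x z, ← and_assoc x (y ⋏ x) z, and_and_self_right, and_assoc]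

theorem and_and_neg_and_self (x y z : α) : x ⋏ y ⋏ ∼(z ⋏ x) = x ⋏ y ⋏ ∼z := by
  rw [← and_and_and_left x y (∼(z ⋏ x)), and_neg_and_self, and_and_and_left]

theorem neg_and_neg_and (x y : α) : ∼x ⋏ ∼(x ⋏ y) = ∼x := by
  calc
    ∼x ⋏ ∼(x ⋏ y)
    _ = ∼x ⋏ ∼(∼∼x ⋏ y) := by rw [neg_neg]
    _ = ∼x := by rw [and_neg_neg_and]

theorem neg_and_self (x : α) : ∼x ⋏ x = ∼x ⋏ F := by
  calc
    ∼x ⋏ x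
    _ = ∼x ⋏ ∼(T ⋏ ∼x) := by rw [T_and, neg_neg]
    _ = ∼x ⋏ F := by rw [and_neg_and_self, neg_T]

theorem neg_and_self_eq_and_F (x : α) : ∼x ⋏ x = x ⋏ F := by
  calc
    ∼x ⋏ x
    _ = ∼∼(∼(x ⋏ ∼F) ⋏ x) := by rw [neg_F, and_T, neg_neg]
    _ = x ⋏ F := by rw [neg_neg_and_neg_and_self, neg_neg]

theorem neg_and_F (x : α) : ∼x ⋏ F = x ⋏ F := by
  rw [← neg_and_self, neg_and_self_eq_and_F]

theorem iff_T (x : α) : x ⇔ T = x := by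
  calc
    x ⇔ T
    _ = ∼∼x := by rw [← neg_cond_eq_iff, neg_T, and_T, neg_and_F, neg_and_neg_and]
    _ = x := by rw [neg_neg]

theorem neg_and_and_eval (x y : α) : ∼(x ⋏ y) ⋏ ∼(x ⋏ F) = ∼(x ⋏ y) := by
  calc
    ∼(x ⋏ y) ⋏ ∼(x ⋏ F)
    _ = ∼∼(∼(x ⋏ (y ⇔ T)) ⋏ ∼(∼x ⋏ ∼T)) := by rw [neg_neg, iff_T, neg_T, neg_and_F]
    _ = ∼(x ⋏ y) := by rw [neg_cond_iff, iff_T]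

theorem F_iff (x : α) : F ⇔ x = ∼x := by
  calc
    F ⇔ x
    _ = ∼(T ⋏ ∼(T ⋏ ∼x)) := by rw [← F_and T, ← neg_cond_iff, neg_F, F_and, neg_F]
    _ = ∼x := by rw [T_and (∼x), neg_neg, T_and]

theorem neg_and_and_self_right (x y : α) : ∼x ⋏ y ⋏ x = ∼x ⋏ y ⋏ F := by
  calc
    ∼x ⋏ y ⋏ x
    _ = ∼x ⋏ y ⋏ ∼(T ⋏ ∼x) := by rw [T_and, neg_neg]
    _ = ∼x ⋏ y ⋏ F := by rw [and_and_neg_and_self, neg_T]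

theorem neg_and_and_self_and (x y z : α) : ∼x ⋏ y ⋏ x ⋏ z = ∼x ⋏ y ⋏ F := by
  calc
    ∼x ⋏ y ⋏ x ⋏ z
    _ = ∼x ⋏ y ⋏ F ⋏ z := by
      rw [← and_assoc y x z, ← and_assoc (∼x) (y ⋏ x) z, neg_and_and_self_right, and_assoc,
        and_assoc]
    _ = ∼x ⋏ y ⋏ F := by rw [F_and]

theorem neg_eval_and_self (x : α) : ∼(∼(x ⋏ F) ⋏ x) = ∼x := by
  calc
    ∼(∼(x ⋏ F) ⋏ x)
    _ = ∼(∼(x ⋏ F) ⋏ ∼(∼x ⋏ ∼F)) := by rw [neg_F, and_T, neg_neg]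
    _ = ∼x := by rw [neg_cond_eq_iff, iff_F]

theorem eval_and_neg (x : α) : ∼(x ⋏ F) ⋏ ∼x = ∼x := by
  rw [← neg_and_F, ← neg_neg (∼(∼x ⋏ F) ⋏ ∼x), neg_eval_and_self, neg_neg (∼x)]

theorem neg_neg_and_and_F_and_self (x y : α) : ∼(∼x ⋏ y ⋏ F) ⋏ x = ∼(∼x ⋏ ∼(y ⋏ x)) := by
  calc
    ∼(∼x ⋏ y ⋏ F) ⋏ x
    _ = ∼(∼x ⋏ y ⋏ F) ⋏ ∼(∼x ⋏ ∼(∼x ⋏ y ⋏ F)) := by rw [and_neg_and_self, neg_neg]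
    _ = ∼(∼x ⋏ ∼(y ⋏ x) ⋏ F) ⋏ ∼(∼x ⋏ ∼(∼x ⋏ y ⋏ F)) := by
      rw [and_neg_self_and, ← neg_and_and_self_and x y F, ← and_assoc y x F, ← neg_and_F (y ⋏ x),
        ← and_neg_self_and (∼x) (y ⋏ F)]
    _ = ∼(∼x ⋏ ∼(y ⋏ x)) := by
      rw [← neg_and_and_self_right x y, and_neg_self_and, ← and_assoc, eval_and_neg]

theorem eval_and_neg_right (x y : α) : ∼(x ⋏ F) ⋏ ∼y = ∼(∼(x ⋏ F) ⋏ y) := by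
  calc
    ∼(x ⋏ F) ⋏ ∼y
    _ = ∼(∼(T ⋏ x ⋏ F) ⋏ y) ⋏ ∼∼(∼F ⋏ ∼(x ⋏ F)) := by
      rw [T_and, neg_F, T_and, neg_neg (x ⋏ F), neg_and_and_self]
    _ = ∼(∼(x ⋏ F) ⋏ y) := by
      rw [← neg_F, ← neg_neg_and_and_F_and_self, neg_and_and_eval, neg_F, T_and]

theorem and_F_iff (x y : α) : x ⋏ F ⇔ y = ∼(∼(x ⋏ F) ⋏ y) := by
  calc
    x ⋏ F ⇔ y
    _ = ∼(∼(x ⋏ F ⋏ (T ⇔ y)) ⋏ ∼(∼(x ⋏ F) ⋏ ∼y)) := by rw [neg_cond_and_iff, F_and]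
    _ = ∼(∼(x ⋏ F) ⋏ y) := by rw [F_and, eval_and_neg_right x y, neg_neg, and_and_self_left]

theorem neg_and_neg_and_neg_and_neg (x y : α) : ∼(∼x ⋏ ∼y) ⋏ ∼(x ⋏ ∼y) = ∼(x ⋏ F) ⋏ y := by
  calc
    ∼(∼x ⋏ ∼y) ⋏ ∼(x ⋏ ∼y)
    _ = ∼∼(∼(∼x ⋏ (F ⇔ y)) ⋏ ∼(∼∼x ⋏ ∼y)) := by rw [neg_neg x, neg_neg, F_iff]
    _ = ∼(x ⋏ F) ⋏ y := by rw [neg_cond_iff, neg_and_F, and_F_iff, neg_neg]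

theorem neg_neg_and_neg_and_right (x y : α) : ∼(∼x ⋏ ∼y) ⋏ y = ∼(x ⋏ F) ⋏ y := by
  calc
    ∼(∼x ⋏ ∼y) ⋏ y
    _ = (∼(∼x ⋏ ∼y) ⋏ ∼(∼x ⋏ F)) ⋏ y := by rw [neg_and_and_eval]
    _ = ∼(x ⋏ F) ⋏ y := by
      rw [neg_and_F, and_assoc, ← neg_and_neg_and_neg_and_neg, and_and_self_left,
        neg_and_neg_and_neg_and_neg]

theorem neg_and_neg_and_right (x y : α) : ∼(x ⋏ ∼y) ⋏ y = ∼(x ⋏ F) ⋏ y := by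
  calc
    ∼(x ⋏ ∼y) ⋏ y
    _ = ∼(∼∼x ⋏ ∼y) ⋏ y := by rw [neg_neg]
    _ = ∼(x ⋏ F) ⋏ y := by rw [neg_neg_and_neg_and_right, neg_and_F]

theorem neg_and_and_and_neg (x y z : α) : ∼(x ⋏ y ⋏ z) ⋏ y ⋏ ∼z = ∼(x ⋏ F) ⋏ y ⋏ ∼z := by
  calc
    ∼(x ⋏ y ⋏ z) ⋏ y ⋏ ∼z
    _ = (∼(x ⋏ ∼∼(y ⋏ z)) ⋏ ∼(y ⋏ z)) ⋏ y := by rw [and_assoc, neg_and_and_self, neg_neg]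
    _ = ∼(x ⋏ F) ⋏ y ⋏ ∼z := by rw [neg_and_neg_and_right, and_assoc, neg_and_and_self]

theorem neg_and_and_eval_and (x y z : α) : ∼(x ⋏ y) ⋏ ∼(x ⋏ F) ⋏ z = ∼(x ⋏ y) ⋏ z := by
  rw [← and_assoc, neg_and_and_eval]

theorem neg_eval_and_and (x y z : α) : ∼(∼(x ⋏ F) ⋏ y) ⋏ z = ∼(x ⋏ F) ⋏ ∼y ⋏ z := by
  calc
    ∼(∼(x ⋏ F) ⋏ y) ⋏ z
    _ = ∼(∼(∼F ⋏ x ⋏ F) ⋏ y) ⋏ ∼(∼(∼F ⋏ x ⋏ F) ⋏ F) ⋏ z := by rw [neg_and_and_eval_and, neg_F, T_and]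
    _ = ∼(∼(x ⋏ F) ⋏ y) ⋏ ∼∼(∼F ⋏ ∼(x ⋏ F)) ⋏ z := by
      rw [neg_neg_and_and_F_and_self, neg_F, T_and (x ⋏ F)]
    _ = ∼(x ⋏ F) ⋏ ∼y ⋏ z := by rw [neg_F, T_and, neg_neg (x ⋏ F), neg_and_and_and]

theorem eval_and_neg_and_and (x y z : α) : ∼(x ⋏ F) ⋏ ∼(x ⋏ y) ⋏ z = ∼(x ⋏ y) ⋏ z := by
  rw [← neg_eval_and_and, neg_and_and_and, neg_F, T_and]

theorem neg_neg_and_and_neg_and_and_neg (x y z : α) :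
    ∼(∼x ⋏ y) ⋏ ∼(x ⋏ z) ⋏ ∼y = ∼(x ⋏ z) ⋏ ∼y := by
  rw [← neg_and_neg_and x z, and_assoc, neg_and_and_and_neg, neg_and_F, eval_and_neg_and_and]

theorem neg_and_comm (x y z : α) : ∼(∼x ⋏ y) ⋏ ∼(x ⋏ z) = ∼(x ⋏ z) ⋏ ∼(∼x ⋏ y) := by
  calc
    ∼(∼x ⋏ y) ⋏ ∼(x ⋏ z)
    _ = ∼(∼x ⋏ ∼x ⋏ y) ⋏ ∼(x ⋏ z) ⋏ ∼(∼x ⋏ y) := by rw [and_and_self_left, and_and_self_right]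
    _ = ∼(x ⋏ z) ⋏ ∼(∼x ⋏ y) := by rw [neg_neg_and_and_neg_and_and_neg]

theorem neg_and_and_neg_and (x y : α) : ∼(x ⋏ y) ⋏ ∼x ⋏ y = ∼(x ⋏ y) ⋏ y := by
  calc
    ∼(x ⋏ y) ⋏ ∼x ⋏ y
    _ = ∼(x ⋏ y) ⋏ ∼(∼x ⋏ ∼y) ⋏ ∼(x ⋏ ∼(x ⋏ y)) := by
      rw [and_and_neg_and_self, neg_and_and_self, neg_neg]
    _ = ∼(x ⋏ y) ⋏ y := by rw [and_neg_self_and, neg_and_neg_and_neg_and_neg, neg_and_and_eval_and]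

theorem neg_and_and_neg_neg_and (x y : α) : ∼(x ⋏ y) ⋏ ∼(∼x ⋏ y) = ∼(∼(x ⋏ F) ⋏ y) := by
  calc
    ∼(x ⋏ y) ⋏ ∼(∼x ⋏ y)
    _ = ∼(x ⋏ y) ⋏ ∼y := by
      rw [← and_neg_self_and (∼(x ⋏ y)) (∼x ⋏ y), neg_and_and_neg_and, and_neg_self_and]
    _ = ∼(x ⋏ ∼∼y) ⋏ ∼y := by rw [neg_neg]
    _ = ∼(∼(x ⋏ F) ⋏ y) := by rw [neg_and_neg_and_right, eval_and_neg_right]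

theorem eval_and_eq (x y : α) : ∼(x ⋏ F) ⋏ y = ∼(x ⋏ ∼y) ⋏ ∼(∼x ⋏ ∼y) := by
  rw [neg_and_and_neg_neg_and, eval_and_neg_right, neg_neg]

/-- The conditional: `y` if `x` holds, and `z` otherwise. -/
def cond (x y z : α) : α := ∼(∼(x ⋏ y) ⋏ ∼(∼x ⋏ z))

theorem iff_eq_cond (x y : α) : x ⇔ y = cond x y (∼y) := (neg_cond_eq_iff x y).symm

theorem cond_T (y z : α) : cond T y z = y := by
  rw [cond, neg_T, T_and, F_and, neg_F, and_T, neg_neg]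

theorem cond_F (y z : α) : cond F y z = z := by
  rw [cond, neg_F, T_and, F_and, neg_F, T_and, neg_neg]

theorem cond_neg (x y z : α) : cond (∼x) z y = cond x y z := by
  rw [cond, cond, neg_neg, neg_and_comm]

theorem and_neg_congr {x y y' : α} (h : x ⋏ y = x ⋏ y') : x ⋏ ∼y = x ⋏ ∼y' := by
  rw [← and_neg_self_and x y, h, and_neg_self_and]

theorem and_and_congr {x y y' z z' : α} (hy : x ⋏ y = x ⋏ y') (hz : x ⋏ z = x ⋏ z') :
    x ⋏ y ⋏ z = x ⋏ y' ⋏ z' := by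
  rw [← and_and_and_left x y z, hz, and_and_and_left, ← and_assoc, hy, and_assoc]

theorem and_cond_congr {x y y' : α} (h : x ⋏ y = x ⋏ y') (z w : α) :
    x ⋏ cond y z w = x ⋏ cond y' z w :=
  and_neg_congr <| and_and_congr (and_neg_congr <| and_and_congr h rfl)
    (and_neg_congr <| and_and_congr (and_neg_congr h) rfl)

theorem and_cond (x y z : α) : x ⋏ cond x y z = x ⋏ y := by
  rw [and_cond_congr (y' := T) (by rw [and_self, and_T]), cond_T]

theorem neg_and_cond (x y z : α) : ∼x ⋏ cond x y z = ∼x ⋏ z := by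
  rw [and_cond_congr (y' := F) (neg_and_self x), cond_F]

theorem eval_and_cond (x y z : α) : ∼(x ⋏ F) ⋏ cond x y z = cond x y z := by
  rw [cond, eval_and_neg_right, eval_and_neg_and_and]

/-- Two terms that both start by evaluating `x` are equal if they agree in both cases. -/
theorem eq_of_and_eq_of_neg_and_eq {x y z : α} (hy : ∼(x ⋏ F) ⋏ y = y) (hz : ∼(x ⋏ F) ⋏ z = z)
    (h : x ⋏ y = x ⋏ z) (h' : ∼x ⋏ y = ∼x ⋏ z) : y = z := by
  rw [← hy, ← hz, eval_and_eq, eval_and_eq x z, and_neg_congr h, and_neg_congr h']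

theorem neg_cond (x y z : α) : ∼(cond x y z) = cond x (∼y) (∼z) := by
  apply eq_of_and_eq_of_neg_and_eq (x := x)
  · rw [eval_and_neg_right, eval_and_cond]
  · rw [eval_and_cond]
  · rw [and_neg_congr (and_cond x y z), and_cond]
  · rw [and_neg_congr (neg_and_cond x y z), neg_and_cond]

theorem cond_cond (x y z u v : α) :
    cond (cond x y z) u v = cond x (cond y u v) (cond z u v) := by
  apply eq_of_and_eq_of_neg_and_eq (x := x)
  · rw [cond.eq_def (cond x y z), eval_and_neg_right, ← and_assoc, eval_and_neg_right,
      ← and_assoc, eval_and_cond]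
  · rw [eval_and_cond]
  · rw [and_cond_congr (and_cond x y z), and_cond]
  · rw [and_cond_congr (neg_and_cond x y z), neg_and_cond]

theorem neg_iff (x y : α) : ∼(x ⇔ y) = x ⇔ ∼y := by
  rw [iff_eq_cond, iff_eq_cond, neg_cond]

theorem neg_iff_neg (x y : α) : ∼x ⇔ ∼y = x ⇔ y := by
  rw [iff_eq_cond, iff_eq_cond, cond_neg, neg_neg]

theorem iff_assoc (x y z : α) : (x ⇔ y) ⇔ z = x ⇔ (y ⇔ z) := by
  rw [iff_eq_cond (x ⇔ y), iff_eq_cond x y, cond_cond, cond_neg, iff_eq_cond x, iff_eq_cond y,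
    neg_cond, neg_neg]

end LeftSeqAlgebra

/-- The setoid of derivable equality in EqMSCLℓI. -/
def DerivLI.setoid : Setoid ITerm :=
  ⟨DerivLI, DerivLI.refl, DerivLI.symm, DerivLI.trans⟩

/-- The free algebra of EqMSCLℓI: terms modulo derivable equality. -/
abbrev DerivLI.TermQuotient : Type := Quotient DerivLI.setoid

instance : LeftSeqAlgebra DerivLI.TermQuotient where
  T := ⟦ITerm.T⟧
  F := ⟦ITerm.F⟧
  neg := Quotient.map ITerm.neg fun _ _ => DerivLI.congr_neg
  and := Quotient.map₂ ITerm.and fun _ _ h _ _ => DerivLI.congr_and h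
  or := Quotient.map₂ ITerm.or fun _ _ h _ _ => DerivLI.congr_or h
  iff := Quotient.map₂ ITerm.iff fun _ _ h _ _ => DerivLI.congr_iff h
  or_def := by rintro ⟨x⟩ ⟨y⟩; exact Quotient.sound (DerivLI.ax_or x y)
  and_or_self := by rintro ⟨x⟩ ⟨y⟩; exact Quotient.sound (DerivLI.ax_abs x y)
  and_assoc := by rintro ⟨x⟩ ⟨y⟩ ⟨z⟩; exact Quotient.sound (DerivLI.ax_assoc x y z)
  T_iff := by rintro ⟨x⟩; exact Quotient.sound (DerivLI.ax_tx x)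
  iff_F := by rintro ⟨x⟩; exact Quotient.sound (DerivLI.ax_xf x)
  and_iff := by rintro ⟨x⟩ ⟨y⟩ ⟨z⟩; exact Quotient.sound (DerivLI.ax_andiff x y z)

/-- In EqMSCLℓI the left-sequential biconditional is associative, negation moves through it,
and it is invariant under negating both arguments. -/
theorem iff_assoc_neg :
    (∀ x y z : ITerm, DerivLI (ITerm.iff (ITerm.iff x y) z) (ITerm.iff x (ITerm.iff y z))) ∧
    (∀ x y : ITerm, DerivLI (ITerm.neg (ITerm.iff x y)) (ITerm.iff x (ITerm.neg y))) ∧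
    (∀ x y : ITerm, DerivLI (ITerm.iff (ITerm.neg x) (ITerm.neg y)) (ITerm.iff x y)) := by
  let q : ITerm → DerivLI.TermQuotient := Quotient.mk DerivLI.setoid
  exact ⟨fun x y z => Quotient.exact (LeftSeqAlgebra.iff_assoc (q x) (q y) (q z)),
    fun x y => Quotient.exact (LeftSeqAlgebra.neg_iff (q x) (q y)),
    fun x y => Quotient.exact (LeftSeqAlgebra.neg_iff_neg (q x) (q y))⟩
end

section
/- EqMSCLℓN together with the defining equations (1ℓ) ¬x = x ⊼ T, (2ℓ) x ∧❛ y = (x ⊼ y) ⊼ T, (3ℓ) x ∨❛ y = (x ⊼ T) ⊼ (y ⊼ T) derives every axiom of EqMSCL; conversely, EqMSCL together with the defining equation x ⊼ y = ¬(x ∧❛ y) derives every axiom of EqMSCLℓN. -/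
/-- Terms built from variables, T, F, ¬, ∧❛, ∨❛, and the left-sequential NAND ⊼. -/
inductive NTerm : Type
  | var : Nat → NTerm
  | T : NTerm
  | F : NTerm
  | neg : NTerm → NTerm
  | and : NTerm → NTerm → NTerm
  | or : NTerm → NTerm → NTerm
  | nand : NTerm → NTerm → NTerm

/-- Derivability from EqMSCLℓN together with the defining equations
(1ℓ) ¬x = x ⊼ T, (2ℓ) x ∧❛ y = (x ⊼ y) ⊼ T, (3ℓ) x ∨❛ y = (x ⊼ T) ⊼ (y ⊼ T)
(axioms taken as schemes, so closure under substitution is built in). -/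
inductive DerivN : NTerm → NTerm → Prop
  | refl (p : NTerm) : DerivN p p
  | symm {p q : NTerm} : DerivN p q → DerivN q p
  | trans {p q r : NTerm} : DerivN p q → DerivN q r → DerivN p r
  | congr_neg {p p' : NTerm} : DerivN p p' → DerivN (NTerm.neg p) (NTerm.neg p')
  | congr_and {p p' q q' : NTerm} : DerivN p p' → DerivN q q' →
      DerivN (NTerm.and p q) (NTerm.and p' q')
  | congr_or {p p' q q' : NTerm} : DerivN p p' → DerivN q q' →
      DerivN (NTerm.or p q) (NTerm.or p' q')
  | congr_nand {p p' q q' : NTerm} : DerivN p p' → DerivN q q' →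
      DerivN (NTerm.nand p q) (NTerm.nand p' q')
  | ax_n1 : DerivN NTerm.F (NTerm.nand NTerm.T NTerm.T)
  | ax_n2 (x y : NTerm) :
      DerivN (NTerm.nand (NTerm.nand NTerm.T x) (NTerm.nand x y)) x
  | ax_n3 (x y z : NTerm) :
      DerivN (NTerm.nand (NTerm.nand x (NTerm.nand y NTerm.T)) z)
             (NTerm.nand
               (NTerm.nand (NTerm.nand x (NTerm.nand (NTerm.nand y z) NTerm.T))
                           (NTerm.nand (NTerm.nand x NTerm.T) z))
               NTerm.T)
  | ax_negdef (x : NTerm) : DerivN (NTerm.neg x) (NTerm.nand x NTerm.T)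
  | ax_anddef (x y : NTerm) :
      DerivN (NTerm.and x y) (NTerm.nand (NTerm.nand x y) NTerm.T)
  | ax_ordef (x y : NTerm) :
      DerivN (NTerm.or x y)
             (NTerm.nand (NTerm.nand x NTerm.T) (NTerm.nand y NTerm.T))

/-- Derivability from EqMSCL together with the defining equation x ⊼ y = ¬(x ∧❛ y)
(axioms taken as schemes, so closure under substitution is built in). -/
inductive DerivE : NTerm → NTerm → Prop
  | refl (p : NTerm) : DerivE p p
  | symm {p q : NTerm} : DerivE p q → DerivE q p
  | trans {p q r : NTerm} : DerivE p q → DerivE q r → DerivE p r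
  | congr_neg {p p' : NTerm} : DerivE p p' → DerivE (NTerm.neg p) (NTerm.neg p')
  | congr_and {p p' q q' : NTerm} : DerivE p p' → DerivE q q' →
      DerivE (NTerm.and p q) (NTerm.and p' q')
  | congr_or {p p' q q' : NTerm} : DerivE p p' → DerivE q q' →
      DerivE (NTerm.or p q) (NTerm.or p' q')
  | congr_nand {p p' q q' : NTerm} : DerivE p p' → DerivE q q' →
      DerivE (NTerm.nand p q) (NTerm.nand p' q')
  | ax_neg : DerivE NTerm.F (NTerm.neg NTerm.T)
  | ax_or (x y : NTerm) :
      DerivE (NTerm.or x y) (NTerm.neg (NTerm.and (NTerm.neg x) (NTerm.neg y)))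
  | ax_tand (x : NTerm) : DerivE (NTerm.and NTerm.T x) x
  | ax_abs (x y : NTerm) : DerivE (NTerm.and x (NTerm.or x y)) x
  | ax_mem (x y z : NTerm) :
      DerivE (NTerm.and (NTerm.or x y) z)
             (NTerm.or (NTerm.and (NTerm.neg x) (NTerm.and y z)) (NTerm.and x z))
  | ax_nanddef (x y : NTerm) :
      DerivE (NTerm.nand x y) (NTerm.neg (NTerm.and x y))

/-- Algebras of the equational theory of left-sequential NAND with constant `𝕋`. -/
class SeqNandAlgebra (A : Type*) where
  top : A
  nand : A → A → A
  absorb (x y : A) : nand (nand top x) (nand x y) = x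
  expand (x y z : A) :
    nand (nand x (nand y top)) z =
      nand (nand (nand x (nand (nand y z) top)) (nand (nand x top) z)) top

namespace SeqNandAlgebra

local infixl:70 "⊼" => SeqNandAlgebra.nand
local notation "𝕋" => SeqNandAlgebra.top

variable {A : Type*} [SeqNandAlgebra A]

theorem top_nand_top_nand_self (x : A) : (𝕋 ⊼ (𝕋 ⊼ x)) ⊼ x = 𝕋 ⊼ x := by
  calc (𝕋 ⊼ (𝕋 ⊼ x)) ⊼ x
    _ = (𝕋 ⊼ (𝕋 ⊼ x)) ⊼ ((𝕋 ⊼ x) ⊼ (x ⊼ 𝕋)) := by rw [absorb x 𝕋]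
    _ = 𝕋 ⊼ x := by rw [absorb (𝕋 ⊼ x) (x ⊼ 𝕋)]

theorem neg_neg_top_nand_neg_nand_top_nand (x y : A) :
    ((𝕋 ⊼ ((x ⊼ (𝕋 ⊼ y)) ⊼ 𝕋)) ⊼ 𝕋) ⊼ 𝕋 = (𝕋 ⊼ (x ⊼ 𝕋)) ⊼ (𝕋 ⊼ y) := by
  calc ((𝕋 ⊼ ((x ⊼ (𝕋 ⊼ y)) ⊼ 𝕋)) ⊼ 𝕋) ⊼ 𝕋
    _ = ((𝕋 ⊼ ((x ⊼ (𝕋 ⊼ y)) ⊼ 𝕋)) ⊼ ((𝕋 ⊼ 𝕋) ⊼ (𝕋 ⊼ y))) ⊼ 𝕋 := by rw [absorb 𝕋 y]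
    _ = (𝕋 ⊼ (x ⊼ 𝕋)) ⊼ (𝕋 ⊼ y) := by rw [← expand 𝕋 x (𝕋 ⊼ y)]

theorem top_nand_neg_top_nand_neg_top : ((𝕋 ⊼ (𝕋 ⊼ 𝕋)) ⊼ (𝕋 ⊼ 𝕋) : A) = (𝕋 ⊼ 𝕋) ⊼ 𝕋 := by
  calc ((𝕋 ⊼ (𝕋 ⊼ 𝕋)) ⊼ (𝕋 ⊼ 𝕋) : A)
    _ = ((𝕋 ⊼ ((𝕋 ⊼ (𝕋 ⊼ 𝕋)) ⊼ 𝕋)) ⊼ 𝕋) ⊼ 𝕋 := by rw [neg_neg_top_nand_neg_nand_top_nand 𝕋 𝕋]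
    _ = (𝕋 ⊼ 𝕋) ⊼ 𝕋 := by conv_lhs => rw [top_nand_top_nand_self 𝕋, top_nand_top_nand_self 𝕋]

theorem neg_nand_nand_top_nand_neg_nand (x y : A) :
    ((x ⊼ y) ⊼ (((𝕋 ⊼ (x ⊼ y)) ⊼ 𝕋) ⊼ y)) ⊼ 𝕋 = ((𝕋 ⊼ (x ⊼ y)) ⊼ (x ⊼ 𝕋)) ⊼ y := by
  calc ((x ⊼ y) ⊼ (((𝕋 ⊼ (x ⊼ y)) ⊼ 𝕋) ⊼ y)) ⊼ 𝕋
    _ = (((𝕋 ⊼ (x ⊼ y)) ⊼ ((x ⊼ y) ⊼ 𝕋)) ⊼ (((𝕋 ⊼ (x ⊼ y)) ⊼ 𝕋) ⊼ y)) ⊼ 𝕋 := by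
      rw [absorb (x ⊼ y) 𝕋]
    _ = ((𝕋 ⊼ (x ⊼ y)) ⊼ (x ⊼ 𝕋)) ⊼ y := by rw [← expand (𝕋 ⊼ (x ⊼ y)) x y]

theorem expand_nand (x y z : A) :
    ((x ⊼ (y ⊼ 𝕋)) ⊼ ((x ⊼ 𝕋) ⊼ (y ⊼ z))) ⊼ 𝕋 = (x ⊼ ((𝕋 ⊼ y) ⊼ 𝕋)) ⊼ (y ⊼ z) := by
  calc ((x ⊼ (y ⊼ 𝕋)) ⊼ ((x ⊼ 𝕋) ⊼ (y ⊼ z))) ⊼ 𝕋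
    _ = ((x ⊼ (((𝕋 ⊼ y) ⊼ (y ⊼ z)) ⊼ 𝕋)) ⊼ ((x ⊼ 𝕋) ⊼ (y ⊼ z))) ⊼ 𝕋 := by rw [absorb y z]
    _ = (x ⊼ ((𝕋 ⊼ y) ⊼ 𝕋)) ⊼ (y ⊼ z) := by rw [← expand x (𝕋 ⊼ y) (y ⊼ z)]

theorem neg_neg_neg_neg_top : ((((𝕋 ⊼ 𝕋) ⊼ 𝕋) ⊼ 𝕋) ⊼ 𝕋 : A) = 𝕋 := by
  calc ((((𝕋 ⊼ 𝕋) ⊼ 𝕋) ⊼ 𝕋) ⊼ 𝕋 : A)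
    _ = (((𝕋 ⊼ (𝕋 ⊼ 𝕋)) ⊼ (𝕋 ⊼ 𝕋)) ⊼ (((𝕋 ⊼ (𝕋 ⊼ 𝕋)) ⊼ 𝕋) ⊼ (𝕋 ⊼ 𝕋))) ⊼ 𝕋 := by
      rw [top_nand_neg_top_nand_neg_top, top_nand_top_nand_self 𝕋, absorb 𝕋 𝕋]
    _ = 𝕋 := by rw [expand_nand (𝕋 ⊼ (𝕋 ⊼ 𝕋)) 𝕋 𝕋, absorb (𝕋 ⊼ 𝕋) 𝕋, absorb 𝕋 𝕋]

theorem neg_nand_neg_top_nand_neg_neg (x : A) :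
    ((x ⊼ (𝕋 ⊼ 𝕋)) ⊼ ((x ⊼ 𝕋) ⊼ 𝕋)) ⊼ 𝕋 = (x ⊼ 𝕋) ⊼ 𝕋 := by
  calc ((x ⊼ (𝕋 ⊼ 𝕋)) ⊼ ((x ⊼ 𝕋) ⊼ 𝕋)) ⊼ 𝕋
    _ = ((x ⊼ (((((𝕋 ⊼ 𝕋) ⊼ 𝕋) ⊼ 𝕋) ⊼ 𝕋) ⊼ 𝕋)) ⊼ ((x ⊼ 𝕋) ⊼ 𝕋)) ⊼ 𝕋 := by rw [neg_neg_neg_neg_top]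
    _ = (x ⊼ 𝕋) ⊼ 𝕋 := by rw [← expand x (((𝕋 ⊼ 𝕋) ⊼ 𝕋) ⊼ 𝕋) 𝕋, neg_neg_neg_neg_top]

theorem nand_neg_neg_top_nand_neg_top (x : A) :
    (x ⊼ ((𝕋 ⊼ 𝕋) ⊼ 𝕋)) ⊼ (𝕋 ⊼ 𝕋) = (x ⊼ (𝕋 ⊼ 𝕋)) ⊼ (𝕋 ⊼ 𝕋) := by
  calc (x ⊼ ((𝕋 ⊼ 𝕋) ⊼ 𝕋)) ⊼ (𝕋 ⊼ 𝕋)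
    _ = ((x ⊼ ((𝕋 ⊼ (𝕋 ⊼ 𝕋)) ⊼ 𝕋)) ⊼ ((x ⊼ 𝕋) ⊼ (𝕋 ⊼ 𝕋))) ⊼ 𝕋 := by
      rw [top_nand_top_nand_self 𝕋, expand_nand x 𝕋 𝕋]
    _ = (x ⊼ (𝕋 ⊼ 𝕋)) ⊼ (𝕋 ⊼ 𝕋) := by rw [← expand x 𝕋 (𝕋 ⊼ 𝕋)]

theorem neg_neg_top_nand_neg_top : (((𝕋 ⊼ 𝕋) ⊼ 𝕋) ⊼ (𝕋 ⊼ 𝕋) : A) = 𝕋 := by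
  calc (((𝕋 ⊼ 𝕋) ⊼ 𝕋) ⊼ (𝕋 ⊼ 𝕋) : A)
    _ = ((𝕋 ⊼ (𝕋 ⊼ 𝕋)) ⊼ ((𝕋 ⊼ 𝕋) ⊼ 𝕋)) ⊼ (𝕋 ⊼ 𝕋) := by
      rw [nand_neg_neg_top_nand_neg_top (𝕋 ⊼ (𝕋 ⊼ 𝕋)), top_nand_neg_top_nand_neg_top]
    _ = 𝕋 := by rw [absorb (𝕋 ⊼ 𝕋) 𝕋, absorb 𝕋 𝕋]

theorem neg_neg_top : ((𝕋 ⊼ 𝕋) ⊼ 𝕋 : A) = 𝕋 := by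
  calc ((𝕋 ⊼ 𝕋) ⊼ 𝕋 : A)
    _ = (𝕋 ⊼ ((((𝕋 ⊼ 𝕋) ⊼ 𝕋) ⊼ 𝕋) ⊼ 𝕋)) ⊼ 𝕋 := by rw [neg_neg_neg_neg_top]
    _ = ((((𝕋 ⊼ 𝕋) ⊼ 𝕋) ⊼ (𝕋 ⊼ 𝕋)) ⊼ ((((𝕋 ⊼ 𝕋) ⊼ 𝕋) ⊼ 𝕋) ⊼ 𝕋)) ⊼ 𝕋 := by
      rw [neg_neg_top_nand_neg_top]
    _ = 𝕋 := by rw [neg_nand_neg_top_nand_neg_neg ((𝕋 ⊼ 𝕋) ⊼ 𝕋), neg_neg_neg_neg_top]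

theorem top_nand_neg_top : (𝕋 ⊼ (𝕋 ⊼ 𝕋) : A) = 𝕋 := by
  calc (𝕋 ⊼ (𝕋 ⊼ 𝕋) : A)
    _ = ((𝕋 ⊼ 𝕋) ⊼ 𝕋) ⊼ (𝕋 ⊼ 𝕋) := by rw [neg_neg_top]
    _ = 𝕋 := by rw [neg_neg_top_nand_neg_top]

theorem top_nand_neg_top_nand (x : A) : 𝕋 ⊼ ((𝕋 ⊼ 𝕋) ⊼ x) = 𝕋 ⊼ 𝕋 := by
  calc 𝕋 ⊼ ((𝕋 ⊼ 𝕋) ⊼ x)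
    _ = (𝕋 ⊼ (𝕋 ⊼ 𝕋)) ⊼ ((𝕋 ⊼ 𝕋) ⊼ x) := by rw [top_nand_neg_top]
    _ = 𝕋 ⊼ 𝕋 := by rw [absorb (𝕋 ⊼ 𝕋) x]

theorem neg_nand_top_nand (x : A) : (((𝕋 ⊼ 𝕋) ⊼ x) ⊼ (𝕋 ⊼ x)) ⊼ 𝕋 = 𝕋 ⊼ x := by
  calc (((𝕋 ⊼ 𝕋) ⊼ x) ⊼ (𝕋 ⊼ x)) ⊼ 𝕋
    _ = (((𝕋 ⊼ 𝕋) ⊼ x) ⊼ (((𝕋 ⊼ ((𝕋 ⊼ 𝕋) ⊼ x)) ⊼ 𝕋) ⊼ x)) ⊼ 𝕋 := by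
      conv_rhs => rw [top_nand_neg_top_nand x, neg_neg_top]
    _ = 𝕋 ⊼ x := by
      conv_lhs => rw [neg_nand_nand_top_nand_neg_nand (𝕋 ⊼ 𝕋) x, top_nand_neg_top_nand x,
        neg_neg_top, neg_neg_top]

theorem neg_top_nand_top_nand_top_nand (x : A) : (𝕋 ⊼ (𝕋 ⊼ (𝕋 ⊼ x))) ⊼ 𝕋 = 𝕋 ⊼ (𝕋 ⊼ x) := by
  calc (𝕋 ⊼ (𝕋 ⊼ (𝕋 ⊼ x))) ⊼ 𝕋
    _ = (((𝕋 ⊼ 𝕋) ⊼ (𝕋 ⊼ x)) ⊼ (𝕋 ⊼ (𝕋 ⊼ x))) ⊼ 𝕋 := by rw [absorb 𝕋 x]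
    _ = 𝕋 ⊼ (𝕋 ⊼ x) := by rw [neg_nand_top_nand (𝕋 ⊼ x)]

theorem neg_top_nand_top_nand (x : A) : (𝕋 ⊼ (𝕋 ⊼ x)) ⊼ 𝕋 = 𝕋 ⊼ (𝕋 ⊼ (𝕋 ⊼ x)) := by
  calc (𝕋 ⊼ (𝕋 ⊼ x)) ⊼ 𝕋
    _ = ((𝕋 ⊼ ((𝕋 ⊼ (𝕋 ⊼ (𝕋 ⊼ x))) ⊼ 𝕋)) ⊼ 𝕋) ⊼ 𝕋 := by
      conv_rhs => rw [neg_top_nand_top_nand_top_nand x, neg_top_nand_top_nand_top_nand x]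
    _ = 𝕋 ⊼ (𝕋 ⊼ (𝕋 ⊼ x)) := by rw [neg_neg_top_nand_neg_nand_top_nand 𝕋 (𝕋 ⊼ x), top_nand_neg_top]

theorem top_nand_top_nand_top_nand_top_nand (x : A) : 𝕋 ⊼ (𝕋 ⊼ (𝕋 ⊼ (𝕋 ⊼ x))) = 𝕋 ⊼ (𝕋 ⊼ x) := by
  calc 𝕋 ⊼ (𝕋 ⊼ (𝕋 ⊼ (𝕋 ⊼ x)))
    _ = (𝕋 ⊼ (𝕋 ⊼ (𝕋 ⊼ x))) ⊼ 𝕋 := by rw [neg_top_nand_top_nand (𝕋 ⊼ x)]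
    _ = 𝕋 ⊼ (𝕋 ⊼ x) := by rw [neg_top_nand_top_nand_top_nand x]

theorem neg_neg_top_nand_neg_neg (x : A) : ((𝕋 ⊼ ((x ⊼ 𝕋) ⊼ 𝕋)) ⊼ 𝕋) ⊼ 𝕋 = (𝕋 ⊼ (x ⊼ 𝕋)) ⊼ 𝕋 := by
  calc ((𝕋 ⊼ ((x ⊼ 𝕋) ⊼ 𝕋)) ⊼ 𝕋) ⊼ 𝕋
    _ = ((𝕋 ⊼ ((x ⊼ 𝕋) ⊼ 𝕋)) ⊼ ((𝕋 ⊼ 𝕋) ⊼ 𝕋)) ⊼ 𝕋 := by rw [neg_neg_top]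
    _ = (𝕋 ⊼ (x ⊼ 𝕋)) ⊼ 𝕋 := by rw [← expand 𝕋 x 𝕋]

theorem neg_neg_top_nand_neg_top_nand (x : A) :
    ((𝕋 ⊼ ((𝕋 ⊼ x) ⊼ 𝕋)) ⊼ 𝕋) ⊼ 𝕋 = 𝕋 ⊼ (𝕋 ⊼ (𝕋 ⊼ x)) := by
  calc ((𝕋 ⊼ ((𝕋 ⊼ x) ⊼ 𝕋)) ⊼ 𝕋) ⊼ 𝕋
    _ = ((𝕋 ⊼ (((((𝕋 ⊼ 𝕋) ⊼ x) ⊼ (𝕋 ⊼ x)) ⊼ 𝕋) ⊼ 𝕋)) ⊼ 𝕋) ⊼ 𝕋 := by rw [neg_nand_top_nand x]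
    _ = 𝕋 ⊼ (𝕋 ⊼ (𝕋 ⊼ x)) := by
      rw [neg_neg_top_nand_neg_neg (((𝕋 ⊼ 𝕋) ⊼ x) ⊼ (𝕋 ⊼ x)), neg_nand_top_nand x,
        neg_top_nand_top_nand x]

theorem neg_top_nand_neg_top_nand_neg_top_nand (x : A) :
    (𝕋 ⊼ ((𝕋 ⊼ ((𝕋 ⊼ x) ⊼ 𝕋)) ⊼ 𝕋)) ⊼ 𝕋 = 𝕋 ⊼ (𝕋 ⊼ x) := by
  calc (𝕋 ⊼ ((𝕋 ⊼ ((𝕋 ⊼ x) ⊼ 𝕋)) ⊼ 𝕋)) ⊼ 𝕋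
    _ = ((𝕋 ⊼ (((𝕋 ⊼ ((𝕋 ⊼ x) ⊼ 𝕋)) ⊼ 𝕋) ⊼ 𝕋)) ⊼ 𝕋) ⊼ 𝕋 := by
      rw [neg_neg_top_nand_neg_neg (𝕋 ⊼ ((𝕋 ⊼ x) ⊼ 𝕋))]
    _ = 𝕋 ⊼ (𝕋 ⊼ x) := by
      rw [neg_neg_top_nand_neg_top_nand x, top_nand_top_nand_top_nand_top_nand x,
        neg_top_nand_top_nand x, neg_top_nand_top_nand (𝕋 ⊼ x),
        top_nand_top_nand_top_nand_top_nand x]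

theorem top_nand_top_nand_neg_top_nand (x : A) : 𝕋 ⊼ (𝕋 ⊼ ((𝕋 ⊼ x) ⊼ 𝕋)) = 𝕋 ⊼ (𝕋 ⊼ x) := by
  calc 𝕋 ⊼ (𝕋 ⊼ ((𝕋 ⊼ x) ⊼ 𝕋))
    _ = (𝕋 ⊼ ((𝕋 ⊼ ((𝕋 ⊼ ((𝕋 ⊼ x) ⊼ 𝕋)) ⊼ 𝕋)) ⊼ 𝕋)) ⊼ 𝕋 := by
      rw [neg_top_nand_neg_top_nand_neg_top_nand ((𝕋 ⊼ x) ⊼ 𝕋)]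
    _ = 𝕋 ⊼ (𝕋 ⊼ x) := by
      rw [neg_top_nand_neg_top_nand_neg_top_nand x, neg_top_nand_top_nand (𝕋 ⊼ x),
        top_nand_top_nand_top_nand_top_nand x]

theorem top_nand_neg_of_top_nand (x : A) : 𝕋 ⊼ ((𝕋 ⊼ x) ⊼ 𝕋) = 𝕋 ⊼ x := by
  calc 𝕋 ⊼ ((𝕋 ⊼ x) ⊼ 𝕋)
    _ = (𝕋 ⊼ (𝕋 ⊼ ((𝕋 ⊼ x) ⊼ 𝕋))) ⊼ ((𝕋 ⊼ x) ⊼ 𝕋) := by rw [top_nand_top_nand_self ((𝕋 ⊼ x) ⊼ 𝕋)]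
    _ = 𝕋 ⊼ x := by rw [top_nand_top_nand_neg_top_nand x, absorb (𝕋 ⊼ x) 𝕋]

theorem neg_top_nand (x : A) : (𝕋 ⊼ x) ⊼ 𝕋 = 𝕋 ⊼ (𝕋 ⊼ x) := by
  calc (𝕋 ⊼ x) ⊼ 𝕋
    _ = (𝕋 ⊼ ((𝕋 ⊼ ((𝕋 ⊼ x) ⊼ 𝕋)) ⊼ 𝕋)) ⊼ 𝕋 := by
      conv_rhs => rw [top_nand_neg_of_top_nand x, top_nand_neg_of_top_nand x]
    _ = 𝕋 ⊼ (𝕋 ⊼ x) := by rw [neg_top_nand_neg_top_nand_neg_top_nand x]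

theorem top_nand_top_nand_top_nand (x : A) : 𝕋 ⊼ (𝕋 ⊼ (𝕋 ⊼ x)) = 𝕋 ⊼ x := by
  calc 𝕋 ⊼ (𝕋 ⊼ (𝕋 ⊼ x))
    _ = 𝕋 ⊼ ((𝕋 ⊼ x) ⊼ 𝕋) := by rw [neg_top_nand x]
    _ = 𝕋 ⊼ x := by rw [top_nand_neg_of_top_nand x]

theorem top_nand_neg_neg (x : A) : 𝕋 ⊼ ((x ⊼ 𝕋) ⊼ 𝕋) = 𝕋 ⊼ (𝕋 ⊼ (x ⊼ 𝕋)) := by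
  calc 𝕋 ⊼ ((x ⊼ 𝕋) ⊼ 𝕋)
    _ = ((𝕋 ⊼ ((x ⊼ 𝕋) ⊼ 𝕋)) ⊼ 𝕋) ⊼ 𝕋 := by
      rw [neg_top_nand ((x ⊼ 𝕋) ⊼ 𝕋), neg_top_nand (𝕋 ⊼ ((x ⊼ 𝕋) ⊼ 𝕋)),
        top_nand_top_nand_top_nand ((x ⊼ 𝕋) ⊼ 𝕋)]
    _ = 𝕋 ⊼ (𝕋 ⊼ (x ⊼ 𝕋)) := by rw [neg_neg_top_nand_neg_neg x, neg_top_nand (x ⊼ 𝕋)]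

theorem expand_nand_top_nand (x y z : A) :
    ((x ⊼ (y ⊼ 𝕋)) ⊼ ((x ⊼ 𝕋) ⊼ (y ⊼ z))) ⊼ 𝕋 = (x ⊼ (𝕋 ⊼ (𝕋 ⊼ y))) ⊼ (y ⊼ z) := by
  calc ((x ⊼ (y ⊼ 𝕋)) ⊼ ((x ⊼ 𝕋) ⊼ (y ⊼ z))) ⊼ 𝕋
    _ = (x ⊼ (𝕋 ⊼ (𝕋 ⊼ y))) ⊼ (y ⊼ z) := by rw [expand_nand x y z, neg_top_nand y]

theorem top_nand_top_nand_neg (x : A) : 𝕋 ⊼ (𝕋 ⊼ (x ⊼ 𝕋)) = x ⊼ 𝕋 := by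
  calc 𝕋 ⊼ (𝕋 ⊼ (x ⊼ 𝕋))
    _ = (𝕋 ⊼ (𝕋 ⊼ ((x ⊼ 𝕋) ⊼ 𝕋))) ⊼ ((x ⊼ 𝕋) ⊼ 𝕋) := by
      rw [top_nand_top_nand_self ((x ⊼ 𝕋) ⊼ 𝕋), top_nand_neg_neg x]
    _ = x ⊼ 𝕋 := by rw [top_nand_neg_neg x, top_nand_top_nand_top_nand (x ⊼ 𝕋), absorb (x ⊼ 𝕋) 𝕋]

theorem neg_top_nand_neg (x : A) : (𝕋 ⊼ 𝕋) ⊼ (x ⊼ 𝕋) = 𝕋 := by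
  calc (𝕋 ⊼ 𝕋) ⊼ (x ⊼ 𝕋)
    _ = (𝕋 ⊼ 𝕋) ⊼ (𝕋 ⊼ (𝕋 ⊼ (x ⊼ 𝕋))) := by rw [top_nand_top_nand_neg x]
    _ = 𝕋 := by rw [absorb 𝕋 (𝕋 ⊼ (x ⊼ 𝕋))]

theorem neg_neg (x : A) : (x ⊼ 𝕋) ⊼ 𝕋 = x := by
  calc (x ⊼ 𝕋) ⊼ 𝕋
    _ = ((𝕋 ⊼ (x ⊼ 𝕋)) ⊼ ((𝕋 ⊼ 𝕋) ⊼ (x ⊼ 𝕋))) ⊼ 𝕋 := by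
      rw [neg_top_nand_neg x, neg_top_nand (x ⊼ 𝕋), top_nand_top_nand_neg x]
    _ = x := by rw [expand_nand_top_nand 𝕋 x 𝕋, top_nand_top_nand_top_nand x, absorb x 𝕋]

theorem nand_top (x : A) : x ⊼ 𝕋 = 𝕋 ⊼ x := by
  have h : 𝕋 ⊼ (𝕋 ⊼ x) = x := by rw [← neg_neg x, top_nand_top_nand_neg]
  calc x ⊼ 𝕋 = ((𝕋 ⊼ x) ⊼ 𝕋) ⊼ 𝕋 := by rw [neg_top_nand x, h]
    _ = 𝕋 ⊼ x := neg_neg _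

theorem top_nand_nand_top (x : A) : (𝕋 ⊼ x) ⊼ 𝕋 = x := by rw [← nand_top, neg_neg]

theorem nand_nand_or_nand_top (x y : A) :
    (x ⊼ ((x ⊼ 𝕋) ⊼ (y ⊼ 𝕋))) ⊼ 𝕋 = x := by
  have h := absorb (x ⊼ 𝕋) (y ⊼ 𝕋)
  rw [← nand_top, neg_neg] at h
  rw [h, neg_neg]

theorem nand_nand_neg_expand (x y z : A) :
    (((x ⊼ 𝕋) ⊼ (y ⊼ 𝕋)) ⊼ z) ⊼ 𝕋 = ((x ⊼ 𝕋) ⊼ ((y ⊼ z) ⊼ 𝕋)) ⊼ (x ⊼ z) := by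
  rw [expand, neg_neg, neg_neg]

end SeqNandAlgebra

/-- Algebras of memorizing short-circuit logic, in the signature `𝕋`, `¬`, `∧`, `∨`. -/
class MemSeqAlgebra (A : Type*) where
  top : A
  neg : A → A
  and : A → A → A
  or : A → A → A
  or_eq (x y : A) : or x y = neg (and (neg x) (neg y))
  top_and (x : A) : and top x = x
  and_or_self (x y : A) : and x (or x y) = x
  or_and (x y z : A) : and (or x y) z = or (and (neg x) (and y z)) (and x z)

namespace MemSeqAlgebra

local prefix:max "∼" => MemSeqAlgebra.neg
local infixl:70 "⋏" => MemSeqAlgebra.and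
local infixl:65 "⋎" => MemSeqAlgebra.or
local notation "𝕋" => MemSeqAlgebra.top

variable {A : Type*} [MemSeqAlgebra A]

theorem top_or (x : A) : 𝕋 ⋎ x = 𝕋 := by
  rw [← top_and (𝕋 ⋎ x), and_or_self]

theorem neg_top_and_or_self (x y : A) : ∼𝕋 ⋏ (x ⋏ y) ⋎ y = y := by
  simpa only [top_or, top_and] using (or_and 𝕋 x y).symm

theorem neg_neg_top_and (x : A) : ∼(∼𝕋 ⋏ x) = 𝕋 := by
  have h := neg_top_and_or_self 𝕋 x
  rw [or_eq] at h
  rw [← h, ← or_eq, top_or]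

theorem neg_neg (x : A) : ∼∼x = x := by
  have h := neg_top_and_or_self 𝕋 x
  rwa [or_eq, neg_neg_top_and, top_and] at h

theorem neg_top_and (x : A) : ∼𝕋 ⋏ x = ∼𝕋 := by
  rw [← neg_neg (∼𝕋 ⋏ x), neg_neg_top_and]

theorem or_neg_top (x : A) : x ⋎ ∼𝕋 = x := by
  have h := or_and ∼𝕋 𝕋 x
  rw [or_eq ∼𝕋 𝕋, neg_neg, top_and, neg_neg, top_and, top_and, neg_top_and] at h
  exact h.symm

theorem and_top (x : A) : x ⋏ 𝕋 = x := by
  have h := or_neg_top ∼x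
  rw [or_eq, neg_neg, neg_neg] at h
  rw [← neg_neg (x ⋏ 𝕋), h, neg_neg]

theorem neg_neg_and_neg_and (x y : A) : ∼(∼x ⋏ ∼(x ⋏ y)) = x := by
  have h := and_or_self ∼x ∼y
  rw [or_eq, neg_neg, neg_neg] at h
  rw [h, neg_neg]

theorem neg_and_neg_and (x y z : A) :
    ∼(x ⋏ ∼y) ⋏ z = ∼(∼(x ⋏ (y ⋏ z)) ⋏ ∼(∼x ⋏ z)) := by
  have h := or_and ∼x y z
  rwa [or_eq, or_eq, neg_neg] at h

end MemSeqAlgebra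

/-- Terms modulo derivability in the NAND system. -/
def derivNSetoid : Setoid NTerm where
  r := DerivN
  iseqv := ⟨DerivN.refl, DerivN.symm, DerivN.trans⟩

instance : SeqNandAlgebra (Quotient derivNSetoid) where
  top := Quotient.mk _ NTerm.T
  nand := Quotient.map₂ NTerm.nand fun _ _ h _ _ k => DerivN.congr_nand h k
  absorb x y := Quotient.inductionOn₂ x y fun p q => Quotient.sound (DerivN.ax_n2 p q)
  expand x y z := Quotient.inductionOn₃ x y z fun p q r => Quotient.sound (DerivN.ax_n3 p q r)

/-- Terms modulo derivability in the short-circuit system. -/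
def derivESetoid : Setoid NTerm where
  r := DerivE
  iseqv := ⟨DerivE.refl, DerivE.symm, DerivE.trans⟩

instance : MemSeqAlgebra (Quotient derivESetoid) where
  top := Quotient.mk _ NTerm.T
  neg := Quotient.map NTerm.neg fun _ _ h => DerivE.congr_neg h
  and := Quotient.map₂ NTerm.and fun _ _ h _ _ k => DerivE.congr_and h k
  or := Quotient.map₂ NTerm.or fun _ _ h _ _ k => DerivE.congr_or h k
  or_eq x y := Quotient.inductionOn₂ x y fun p q => Quotient.sound (DerivE.ax_or p q)
  top_and x := Quotient.inductionOn x fun p => Quotient.sound (DerivE.ax_tand p)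
  and_or_self x y := Quotient.inductionOn₂ x y fun p q => Quotient.sound (DerivE.ax_abs p q)
  or_and x y z := Quotient.inductionOn₃ x y z fun p q r => Quotient.sound (DerivE.ax_mem p q r)

/-- The class of a term modulo derivability in the NAND system. -/
def nandClass (p : NTerm) : Quotient derivNSetoid := Quotient.mk _ p

theorem nandClass_T : nandClass NTerm.T = SeqNandAlgebra.top := rfl

theorem nandClass_neg (p : NTerm) :
    nandClass (NTerm.neg p) = SeqNandAlgebra.nand (nandClass p) SeqNandAlgebra.top :=
  Quotient.sound (DerivN.ax_negdef p)

theorem nandClass_and (p q : NTerm) :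
    nandClass (NTerm.and p q) =
      SeqNandAlgebra.nand (SeqNandAlgebra.nand (nandClass p) (nandClass q)) SeqNandAlgebra.top :=
  Quotient.sound (DerivN.ax_anddef p q)

theorem nandClass_or (p q : NTerm) :
    nandClass (NTerm.or p q) =
      SeqNandAlgebra.nand (SeqNandAlgebra.nand (nandClass p) SeqNandAlgebra.top)
        (SeqNandAlgebra.nand (nandClass q) SeqNandAlgebra.top) :=
  Quotient.sound (DerivN.ax_ordef p q)

theorem DerivN.of_nandClass_eq {p q : NTerm} (h : nandClass p = nandClass q) : DerivN p q :=
  Quotient.exact h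

/-- The class of a term modulo derivability in the short-circuit system. -/
def seqClass (p : NTerm) : Quotient derivESetoid := Quotient.mk _ p

theorem seqClass_T : seqClass NTerm.T = MemSeqAlgebra.top := rfl

theorem seqClass_nand (p q : NTerm) :
    seqClass (NTerm.nand p q) =
      MemSeqAlgebra.neg (MemSeqAlgebra.and (seqClass p) (seqClass q)) :=
  Quotient.sound (DerivE.ax_nanddef p q)

theorem seqClass_F : seqClass NTerm.F = MemSeqAlgebra.neg MemSeqAlgebra.top :=
  Quotient.sound DerivE.ax_neg

theorem DerivE.of_seqClass_eq {p q : NTerm} (h : seqClass p = seqClass q) : DerivE p q :=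
  Quotient.exact h

/-- EqMSCLℓN + (1ℓ),(2ℓ),(3ℓ) derives every axiom of EqMSCL; conversely,
EqMSCL + (x ⊼ y = ¬(x ∧❛ y)) derives every axiom of EqMSCLℓN. -/
theorem eqmscl_ln_correspondence :
    ((DerivN NTerm.F (NTerm.neg NTerm.T)) ∧
     (∀ x y : NTerm, DerivN (NTerm.or x y)
         (NTerm.neg (NTerm.and (NTerm.neg x) (NTerm.neg y)))) ∧
     (∀ x : NTerm, DerivN (NTerm.and NTerm.T x) x) ∧
     (∀ x y : NTerm, DerivN (NTerm.and x (NTerm.or x y)) x) ∧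
     (∀ x y z : NTerm, DerivN (NTerm.and (NTerm.or x y) z)
         (NTerm.or (NTerm.and (NTerm.neg x) (NTerm.and y z)) (NTerm.and x z)))) ∧
    ((DerivE NTerm.F (NTerm.nand NTerm.T NTerm.T)) ∧
     (∀ x y : NTerm, DerivE (NTerm.nand (NTerm.nand NTerm.T x) (NTerm.nand x y)) x) ∧
     (∀ x y z : NTerm, DerivE
         (NTerm.nand (NTerm.nand x (NTerm.nand y NTerm.T)) z)
         (NTerm.nand
           (NTerm.nand (NTerm.nand x (NTerm.nand (NTerm.nand y z) NTerm.T))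
                       (NTerm.nand (NTerm.nand x NTerm.T) z))
           NTerm.T))) := by
  refine ⟨⟨?_, fun x y => ?_, fun x => ?_, fun x y => ?_, fun x y z => ?_⟩,
    ?_, fun x y => ?_, fun x y z => ?_⟩
  · exact DerivN.ax_n1.trans (DerivN.ax_negdef _).symm
  · apply DerivN.of_nandClass_eq
    simp only [nandClass_or, nandClass_neg, nandClass_and, SeqNandAlgebra.neg_neg]
  · apply DerivN.of_nandClass_eq
    simp only [nandClass_and, nandClass_T, SeqNandAlgebra.top_nand_nand_top]
  · apply DerivN.of_nandClass_eq
    simp only [nandClass_and, nandClass_or, SeqNandAlgebra.nand_nand_or_nand_top]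
  · apply DerivN.of_nandClass_eq
    simp only [nandClass_and, nandClass_or, nandClass_neg, SeqNandAlgebra.neg_neg,
      SeqNandAlgebra.nand_nand_neg_expand]
  · apply DerivE.of_seqClass_eq
    rw [seqClass_nand, seqClass_F, seqClass_T, MemSeqAlgebra.top_and]
  · apply DerivE.of_seqClass_eq
    simp only [seqClass_nand, seqClass_T, MemSeqAlgebra.top_and,
      MemSeqAlgebra.neg_neg_and_neg_and]
  · apply DerivE.of_seqClass_eq
    simp only [seqClass_nand, seqClass_T, MemSeqAlgebra.and_top, MemSeqAlgebra.neg_neg,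
      MemSeqAlgebra.neg_and_neg_and]
end
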